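/- arXiv:1912.03396 — 2 statements merged into one kernel-verified Lean document; each statement's English description precedes it below -/
import Mathlib

section
/- Every planar graph G contains a matching 𝓜 such that the graph polynomial P_{G−𝓜} contains a nonvanishing monomial whose degree with respect to every variable is at most 3 (equivalently, every planar graph G contains a matching 𝓜 such that the Alon–Tarsi number of G − 𝓜 is at most 4). -/
/-- `H` is a minor of `G`: there is a family of nonempty, pairwise disjoint, connected
branch sets in `G`, one for each vertex of `H`, such that every edge of `H` is realized by
an edge of `G` between the corresponding branch sets. -/
def SimpleGraph.IsMinorOf {W V : Type} (H : SimpleGraph W) (G : SimpleGraph V) : Prop :=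
  ∃ B : W → Set V,
    (∀ w, (B w).Nonempty) ∧
    (∀ w, (G.induce (B w)).Connected) ∧
    (∀ w w', w ≠ w' → Disjoint (B w) (B w')) ∧
    (∀ w w', H.Adj w w' → ∃ a ∈ B w, ∃ b ∈ B w', G.Adj a b)

/-- A graph is planar iff it has no `K₅` and no `K₃,₃` minor (Kuratowski–Wagner). -/
def SimpleGraph.Planar {V : Type} (G : SimpleGraph V) : Prop :=
  ¬ (completeGraph (Fin 5)).IsMinorOf G ∧
  ¬ (completeBipartiteGraph (Fin 3) (Fin 3)).IsMinorOf G

open MvPolynomial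

/-- The graph polynomial `P_G = ∏_{xy ∈ E(G)} (x - y)`, with each edge oriented from its
smaller to its larger endpoint. -/
noncomputable def graphPoly {V : Type} [Fintype V] [DecidableEq V] [LinearOrder V]
    (G : SimpleGraph V) : MvPolynomial V ℤ :=
  letI : Fintype G.edgeSet := Fintype.ofFinite _
  ∏ e ∈ G.edgeFinset,
    Sym2.lift ⟨fun a b => (X (min a b) : MvPolynomial V ℤ) - X (max a b),
      fun a b => by simp only [min_comm a b, max_comm a b]⟩ e

/-! ### Products of edge factors -/

section Algebra

variable {V : Type} {φ : Sym2 V → MvPolynomial V ℤ}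

/-- `φ` assigns to each edge the difference of its endpoints, up to sign. -/
def IsEdgeFactor (φ : Sym2 V → MvPolynomial V ℤ) : Prop :=
  ∀ a b, φ s(a, b) = X a - X b ∨ φ s(a, b) = X b - X a

lemma IsEdgeFactor.isHomogeneous_prod (hφ : IsEdgeFactor φ) (F : Finset (Sym2 V)) :
    (∏ e ∈ F, φ e).IsHomogeneous F.card := by
  have : F.card = ∑ _e ∈ F, 1 := by simp
  rw [this]
  refine IsHomogeneous.prod _ _ _ fun e _ => ?_
  induction e with
  | _ a b =>
    rcases hφ a b with h | h <;> rw [h] <;>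
      exact (isHomogeneous_X _ _).sub (isHomogeneous_X _ _)

variable [DecidableEq V]

lemma sum_single_one_apply (N : Finset V) (u : V) :
    (∑ x ∈ N, Finsupp.single x 1 : V →₀ ℕ) u = if u ∈ N then 1 else 0 := by
  simp [Finsupp.finsetSum_apply, Finsupp.single_apply]

lemma coeff_mul_X_sub_X (Q : MvPolynomial V ℤ) (m : V →₀ ℕ) (a b : V) :
    coeff m (Q * (X a - X b)) =
      (if a ∈ m.support then coeff (m - Finsupp.single a 1) Q else 0) -
        (if b ∈ m.support then coeff (m - Finsupp.single b 1) Q else 0) := by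
  rw [mul_sub, coeff_sub, coeff_mul_X', coeff_mul_X']

lemma IsEdgeFactor.coeff_add_single (hφ : IsEdgeFactor φ) (Q : MvPolynomial V ℤ)
    {m : V →₀ ℕ} {v u : V} (hvu : v ≠ u) (hm : m v = 0) :
    coeff (m + Finsupp.single u 1) (Q * φ s(v, u)) ≠ 0 ↔ coeff m Q ≠ 0 := by
  rcases hφ v u with h | h <;> rw [h, coeff_mul_X_sub_X] <;>
    simp [hm, hvu.symm]

lemma IsEdgeFactor.coeff_add_sum (hφ : IsEdgeFactor φ) (Q : MvPolynomial V ℤ)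
    {v : V} {m : V →₀ ℕ} (hm : m v = 0) (N : Finset V) (hv : v ∉ N) :
    coeff (m + ∑ u ∈ N, Finsupp.single u 1) (Q * ∏ u ∈ N, φ s(v, u)) ≠ 0 ↔
      coeff m Q ≠ 0 := by
  induction N using Finset.induction_on with
  | empty => simp
  | insert u N hu ih =>
    simp only [Finset.mem_insert, not_or] at hv
    rw [Finset.prod_insert hu, Finset.sum_insert hu, mul_comm (φ _), ← mul_assoc,
      add_comm (Finsupp.single u 1), ← add_assoc, hφ.coeff_add_single _ hv.1, ih hv.2]
    simp only [Finsupp.add_apply, hm, Finsupp.finsetSum_apply, zero_add]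
    exact Finset.sum_eq_zero fun x hx =>
      Finsupp.single_eq_of_ne (fun h => hv.2 (h ▸ hx))

lemma IsEdgeFactor.coeff_add_single_card (hφ : IsEdgeFactor φ) (Q : MvPolynomial V ℤ)
    {v : V} {m : V →₀ ℕ} (K : Finset V) (hv : v ∉ K) (hm : ∀ k ∈ K, m k = 0) :
    coeff (m + Finsupp.single v K.card) (Q * ∏ u ∈ K, φ s(v, u)) ≠ 0 ↔
      coeff m Q ≠ 0 := by
  induction K using Finset.induction_on with
  | empty => simp
  | insert u K hu ih =>
    simp only [Finset.mem_insert, not_or, forall_eq_or_imp] at hv hm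
    rw [Finset.prod_insert hu, Finset.card_insert_of_notMem hu, mul_comm (φ _), ← mul_assoc,
      Finsupp.single_add, ← add_assoc, Sym2.eq_swap,
      hφ.coeff_add_single _ (Ne.symm hv.1), ih hv.2 hm.2]
    simp [hm.1, Ne.symm hv.1]

/-- If one unit of degree is given to `v`, then it is taken from a neighbour of `v`. -/
lemma IsEdgeFactor.exists_coeff_ne_zero (hφ : IsEdgeFactor φ) {Q : MvPolynomial V ℤ}
    {v : V} (hQ : ∀ m, coeff m Q ≠ 0 → m v = 0) {m : V →₀ ℕ} (hm : m v = 0) (N : Finset V)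
    (hv : v ∉ N)
    (h : coeff (m + ∑ u ∈ N, Finsupp.single u 1 + Finsupp.single v 1)
      (Q * ∏ u ∈ N, φ s(v, u)) ≠ 0) :
    ∃ u ∈ N, coeff (m + Finsupp.single u 1) Q ≠ 0 := by
  induction N using Finset.induction_on with
  | empty =>
    have := hQ (m + Finsupp.single v 1) (by simpa using h)
    simp at this
  | insert u N hu ih =>
    simp only [Finset.mem_insert, not_or] at hv
    by_cases h1 : coeff (m + Finsupp.single u 1) Q = 0
    · have h2 : coeff (m + Finsupp.single u 1 + ∑ u ∈ N, Finsupp.single u 1)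
          (Q * ∏ u ∈ N, φ s(v, u)) = 0 := by
        by_contra h3
        exact (hφ.coeff_add_sum Q (by simp [hm, Ne.symm hv.1]) N hv.2).1 h3 h1
      obtain ⟨y, hy, hy'⟩ := ih hv.2 (fun h3 => h (by
        have e1 : m + ∑ u ∈ insert u N, Finsupp.single u 1 + Finsupp.single v 1 -
            Finsupp.single u 1 = m + ∑ u ∈ N, Finsupp.single u 1 + Finsupp.single v 1 := by
          rw [Finset.sum_insert hu]; ext z; simp; omega
        have e2 : m + ∑ u ∈ insert u N, Finsupp.single u 1 + Finsupp.single v 1 -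
            Finsupp.single v 1 = m + Finsupp.single u 1 + ∑ u ∈ N, Finsupp.single u 1 := by
          rw [Finset.sum_insert hu]; ext z; simp; omega
        rw [Finset.prod_insert hu, mul_comm (φ _), ← mul_assoc]
        rcases hφ v u with h' | h' <;> rw [h', coeff_mul_X_sub_X, e1, e2, h2, h3] <;> simp))
      exact ⟨y, Finset.mem_insert_of_mem hy, hy'⟩
    · exact ⟨u, Finset.mem_insert_self _ _, h1⟩

/-- A unit of degree moves from `w` to `v`, or a nonvanishing monomial of smaller degree in `w`
appears. -/
lemma IsEdgeFactor.coeff_shift (hφ : IsEdgeFactor φ) {Q : MvPolynomial V ℤ} {m : V →₀ ℕ}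
    {v w : V} (hQ : coeff m Q ≠ 0)
    (h : coeff (m + Finsupp.single v 1) (Q * φ s(v, w)) = 0) :
    coeff (m + Finsupp.single v 1 - Finsupp.single w 1) Q ≠ 0 := by
  intro h0
  apply hQ
  rcases hφ v w with h' | h' <;> rw [h', coeff_mul_X_sub_X, h0] at h <;> simpa using h

lemma IsEdgeFactor.exists_mem_of_coeff_ne_zero (hφ : IsEdgeFactor φ) (F : Finset (Sym2 V))
    (v : V) : ∀ m, coeff m (∏ e ∈ F, φ e) ≠ 0 → m v ≠ 0 → ∃ e ∈ F, v ∈ e := by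
  induction F using Finset.induction_on with
  | empty =>
    intro m hm hv
    rw [Finset.prod_empty, coeff_one] at hm
    simp only [ne_eq, ite_eq_right_iff, one_ne_zero, imp_false, not_not] at hm
    simp [← hm] at hv
  | insert e F he ih =>
    intro m hm hv
    by_contra! hcon
    rw [Finset.prod_insert he, mul_comm] at hm
    have key : ∀ u : V, u ∈ e → ∀ m', m' = m - Finsupp.single u 1 →
        coeff m' (∏ e ∈ F, φ e) = 0 := by
      rintro u hu m' rfl
      by_contra h0
      have huv : u ≠ v := fun h => hcon e (Finset.mem_insert_self _ _) (h ▸ hu)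
      obtain ⟨e', he', hv'⟩ := ih _ h0 (by simpa [huv] using hv)
      exact hcon e' (Finset.mem_insert_of_mem he') hv'
    induction e with
    | _ a b =>
      have ha := key a (Sym2.mem_mk_left a b) _ rfl
      have hb := key b (Sym2.mem_mk_right a b) _ rfl
      rcases hφ a b with h | h <;> rw [h, coeff_mul_X_sub_X, ha, hb] at hm <;> simp at hm

/-- Nonvanishing monomials of two products multiply if the second one is supported outside the
variables of the first factor. -/
lemma IsEdgeFactor.coeff_mul_prod (hφ : IsEdgeFactor φ) (F₁ F₂ : Finset (Sym2 V))
    {m₁ m₂ : V →₀ ℕ} (h₁ : coeff m₁ (∏ e ∈ F₁, φ e) ≠ 0) (h₂ : coeff m₂ (∏ e ∈ F₂, φ e) ≠ 0)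
    (hm : ∀ v, ∀ e ∈ F₁, v ∈ e → m₂ v = 0) :
    coeff (m₁ + m₂) ((∏ e ∈ F₁, φ e) * ∏ e ∈ F₂, φ e) ≠ 0 := by
  have hvan : ∀ m v, coeff m (∏ e ∈ F₁, φ e) ≠ 0 → m₂ v ≠ 0 → m v = 0 := by
    intro m v hc hv
    by_contra h0
    obtain ⟨e, he, hve⟩ := hφ.exists_mem_of_coeff_ne_zero F₁ v m hc h0
    exact hv (hm v e he hve)
  have hdeg : ∀ m, coeff m (∏ e ∈ F₂, φ e) ≠ 0 → m.degree = F₂.card := fun m hc => by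
    by_contra h0
    exact hc ((hφ.isHomogeneous_prod F₂).coeff_eq_zero h0)
  rw [coeff_mul, Finset.sum_eq_single (m₁, m₂)]
  · exact mul_ne_zero h₁ h₂
  · rintro ⟨p₁, p₂⟩ hp hne
    rw [Finset.HasAntidiagonal.mem_antidiagonal] at hp
    by_contra h0
    obtain ⟨hp₁, hp₂⟩ := mul_ne_zero_iff.mp h0
    have hle : m₂ ≤ p₂ := fun v => by
      by_cases hv : m₂ v = 0
      · simp [hv]
      · have := DFunLike.congr_fun hp v
        simp only [Finsupp.add_apply, hvan _ v hp₁ hv, hvan _ v h₁ hv] at this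
        omega
    have hzero : p₂ - m₂ = 0 := by
      have e : p₂ - m₂ + m₂ = p₂ := tsub_add_cancel_of_le hle
      have := congrArg Finsupp.degree e
      rw [map_add, hdeg _ hp₂, hdeg _ h₂] at this
      exact (Finsupp.degree_eq_zero_iff _).mp (by omega)
    have heq : p₂ = m₂ := le_antisymm (tsub_eq_zero_iff_le.mp hzero) hle
    subst heq
    exact hne (Prod.ext (add_right_cancel hp) rfl)
  · intro h
    exact absurd (by simp) h

end Algebra

/-! ### Matchings with a nonvanishing monomial of small degree -/

section Matching

variable {V : Type} [Fintype V] [DecidableEq V] {φ : Sym2 V → MvPolynomial V ℤ}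
  {G : SimpleGraph V} {U T : Finset V} {S S' : Set V}

open Classical in
/-- The edges of `G` inside `U` that are not contained in `T`. -/
noncomputable def edgesInside (G : SimpleGraph V) (U T : Finset V) : Finset (Sym2 V) :=
  {e | e ∈ G.edgeSet ∧ (∀ v ∈ e, v ∈ U) ∧ ∃ v ∈ e, v ∉ T}

lemma mem_edgesInside {e : Sym2 V} : e ∈ edgesInside G U T ↔
    e ∈ G.edgeSet ∧ (∀ v ∈ e, v ∈ U) ∧ ∃ v ∈ e, v ∉ T := by
  simp [edgesInside]

/-- There is a matching in `U \ T` whose deletion, together with that of the edges inside `T`,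
leaves in `U` a graph with a nonvanishing monomial of degree `0` on `T`, at most `3` on `U`, and
at most `2` on `S`, where a matching edge counts towards the degree. -/
def HasGoodMatching (φ : Sym2 V → MvPolynomial V ℤ) (G : SimpleGraph V) (U : Finset V)
    (S : Set V) (T : Finset V) : Prop :=
  ∃ (M : Finset (Sym2 V)) (m : V →₀ ℕ),
    (∀ e ∈ M, e ∈ G.edgeSet) ∧
    (∀ e ∈ M, ∀ v ∈ e, v ∈ U ∧ v ∉ T) ∧
    (∀ e ∈ M, ∀ e' ∈ M, ∀ v, v ∈ e → v ∈ e' → e = e') ∧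
    coeff m (∏ e ∈ edgesInside G U T \ M, φ e) ≠ 0 ∧
    (∀ v ∈ T, m v = 0) ∧
    (∀ v ∈ U, m v ≤ 3) ∧
    (∀ v ∈ U, v ∈ S → m v ≤ 2) ∧
    (∀ v ∈ U, v ∈ S → ∀ e ∈ M, v ∈ e → m v ≤ 1)

lemma hasGoodMatching_empty : HasGoodMatching φ G ∅ S ∅ := by
  refine ⟨∅, 0, by simp, by simp, by simp, ?_, by simp, by simp, by simp, by simp⟩
  have : edgesInside G (∅ : Finset V) ∅ = ∅ := by
    refine Finset.eq_empty_of_forall_notMem fun e he => ?_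
    obtain ⟨v, hv, -⟩ := (mem_edgesInside.mp he).2.2
    simpa using (mem_edgesInside.mp he).2.1 v hv
  simp [this]

/-- Split off the edges at a vertex. -/
lemma prod_edgesInside_eq {M M' : Finset (Sym2 V)} {N : Finset V} {v : V} (hv : v ∈ U)
    (hN : ∀ u, u ∈ N ↔ u ∈ U ∧ G.Adj v u ∧ s(v, u) ∉ M ∧ ¬ (v ∈ T ∧ u ∈ T))
    (hM : ∀ e, v ∉ e → (e ∈ M ↔ e ∈ M')) :
    ∏ e ∈ edgesInside G U T \ M, φ e =
      (∏ e ∈ edgesInside G (U.erase v) (T.erase v) \ M', φ e) * ∏ u ∈ N, φ s(v, u) := by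
  have hinj : Set.InjOn (fun u => s(v, u)) (N : Set V) := fun a _ b _ h =>
    Sym2.congr_right.mp h
  rw [← Finset.prod_image (g := fun u => s(v, u)) hinj, ← Finset.prod_union]
  · congr 1
    ext e
    simp only [Finset.mem_sdiff, Finset.mem_union, Finset.mem_image, mem_edgesInside]
    by_cases hve : v ∈ e
    · obtain ⟨b, rfl⟩ := Sym2.mem_iff_exists.mp hve
      simp only [Sym2.mem_iff, Finset.mem_erase, SimpleGraph.mem_edgeSet, forall_eq_or_imp,
        forall_eq, exists_eq_or_imp, exists_eq_left, Sym2.congr_right, exists_eq_right, hN]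
      grind
    · have h1 : ¬ ∃ u ∈ N, s(v, u) = e := by
        rintro ⟨u, -, rfl⟩
        simp at hve
      have h2 : ∀ u ∈ e, u ≠ v := fun u hu h => hve (h ▸ hu)
      simp only [h1, or_false, hM e hve, Finset.mem_erase]
      grind
  · rw [Finset.disjoint_left]
    intro e he he'
    obtain ⟨u, -, rfl⟩ := Finset.mem_image.mp he'
    have := (mem_edgesInside.mp (Finset.mem_sdiff.mp he).1).2.1 v (by simp)
    simp at this

lemma HasGoodMatching.of_singleton {x : V} (h : HasGoodMatching φ G U S {x}) :
    HasGoodMatching φ G U S ∅ := by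
  obtain ⟨M, m, h1, h2, h3, h4, h5, h6, h7, h8⟩ := h
  refine ⟨M, m, h1, fun e he v hv => ⟨(h2 e he v hv).1, by simp⟩, h3, ?_, by simp, h6, h7, h8⟩
  have : edgesInside G U ∅ = edgesInside G U {x} := by
    ext e
    induction e with
    | _ a b =>
      simp only [mem_edgesInside, SimpleGraph.mem_edgeSet, Sym2.mem_iff]
      constructor
      · rintro ⟨hab, hU, -⟩
        refine ⟨hab, hU, ?_⟩
        by_contra! hcon
        have ha := hcon a (Or.inl rfl)
        have hb := hcon b (Or.inr rfl)
        simp only [Finset.mem_singleton] at ha hb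
        exact hab.ne (ha.trans hb.symm)
      · rintro ⟨hab, hU, -⟩
        exact ⟨hab, hU, a, by simp⟩
  rwa [this]

lemma HasGoodMatching.of_pair (hφ : IsEdgeFactor φ) {x y : V} (hxy : G.Adj x y) (hx : x ∈ U)
    (hy : y ∈ U) (h : HasGoodMatching φ G U S {x, y}) : HasGoodMatching φ G U S {x} := by
  obtain ⟨M, m, h1, h2, h3, h4, h5, h6, h7, h8⟩ := h
  have hyM : ∀ e ∈ M, y ∉ e := fun e he hye => (h2 e he y hye).2 (by simp)
  have hmy : m y = 0 := h5 y (by simp)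
  have hmx : m x = 0 := h5 x (by simp)
  have hE : edgesInside G U {x} \ M = insert s(x, y) (edgesInside G U {x, y} \ M) := by
    ext e
    simp only [Finset.mem_sdiff, Finset.mem_insert, mem_edgesInside]
    constructor
    · rintro ⟨⟨he, hU, v, hv, hvx⟩, hM⟩
      by_cases hexy : e = s(x, y)
      · exact Or.inl hexy
      · refine Or.inr ⟨⟨he, hU, ?_⟩, hM⟩
        by_contra! hcon
        induction e with
        | _ a b =>
          have ha := hcon a (by simp)
          have hb := hcon b (by simp)
          have hab : a ≠ b := SimpleGraph.Adj.ne he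
          simp only [Finset.mem_singleton] at ha hb
          rcases ha with rfl | rfl <;> rcases hb with rfl | rfl <;>
            simp_all [Sym2.eq_swap]
    · rintro (rfl | ⟨⟨he, hU, v, hv, hvx⟩, hM⟩)
      · refine ⟨⟨hxy, ?_, y, by simp, by simpa using hxy.ne'⟩, fun hM => hyM _ hM (by simp)⟩
        simp [hx, hy]
      · refine ⟨⟨he, hU, v, hv, ?_⟩, hM⟩
        simp only [not_or] at hvx
        simpa using hvx.1
  refine ⟨M, m + Finsupp.single y 1, h1, ?_, h3, ?_, ?_, ?_, ?_, ?_⟩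
  · intro e he v hv
    have := h2 e he v hv
    simp_all
  · rw [hE, Finset.prod_insert (by simp [mem_edgesInside]), mul_comm]
    exact (hφ.coeff_add_single _ hxy.ne hmx).2 h4
  · simp [hmx, hxy.ne]
  · intro v hv
    have := h6 v hv
    by_cases hvy : v = y
    · subst hvy; simp [hmy]
    · simpa [Ne.symm hvy] using this
  · intro v hv hS
    have := h7 v hv hS
    by_cases hvy : v = y
    · subst hvy; simp [hmy]
    · simpa [Ne.symm hvy] using this
  · intro v hv hS e he hve
    have hvy : v ≠ y := fun h => hyM e he (h ▸ hve)
    simpa [Ne.symm hvy] using h8 v hv hS e he hve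

/-- Delete a vertex and give it degree `0`. -/
lemma HasGoodMatching.of_erase (hφ : IsEdgeFactor φ) {x : V} (hx : x ∈ U)
    (hTS : ∀ v ∈ T, v ∈ S) (hT : x ∈ T ∨ T = ∅)
    (hS : ∀ u ∈ U, G.Adj x u → u ∈ S → u ∈ T)
    (hSS' : ∀ u ∈ U, u ≠ x → u ∈ S → u ∈ S') (hS' : ∀ u, G.Adj x u → u ∈ S')
    (h : HasGoodMatching φ G (U.erase x) S' (T.erase x)) : HasGoodMatching φ G U S T := by
  classical
  obtain ⟨M, m, h1, h2, h3, h4, h5, h6, h7, h8⟩ := h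
  have hxM : ∀ e ∈ M, x ∉ e := fun e he hxe => by simpa using (h2 e he x hxe).1
  have hmx : m x = 0 := by
    by_contra h0
    obtain ⟨e, he, hxe⟩ := hφ.exists_mem_of_coeff_ne_zero _ x m h4 h0
    simpa using (mem_edgesInside.mp (Finset.mem_sdiff.mp he).1).2.1 x hxe
  set N : Finset V := U.filter (fun u => G.Adj x u ∧ u ∉ T) with hNdef
  have hxN : x ∉ N := by simp [hNdef]
  have hNS : ∀ u ∈ N, u ∉ S := by
    intro u hu huS
    simp only [hNdef, Finset.mem_filter] at hu
    exact hu.2.2 (hS u hu.1 hu.2.1 huS)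
  have hN2 : ∀ u ∈ N, m u ≤ 2 := by
    intro u hu
    have hux : u ≠ x := fun h => hxN (h ▸ hu)
    simp only [hNdef, Finset.mem_filter] at hu
    exact h7 u (by simp [hux, hu.1]) (hS' u hu.2.1)
  refine ⟨M, m + ∑ u ∈ N, Finsupp.single u 1, h1, ?_, h3, ?_, ?_, ?_, ?_, ?_⟩
  · intro e he v hv
    have := h2 e he v hv
    simp only [Finset.mem_erase] at this
    tauto
  · rw [prod_edgesInside_eq (M' := M) (N := N) hx ?_ (fun _ _ => Iff.rfl)]
    · exact (hφ.coeff_add_sum _ hmx N hxN).2 h4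
    · intro u
      have : s(x, u) ∉ M := fun h => hxM _ h (by simp)
      rcases hT with hT | hT <;> simp [hNdef, this, hT]
  all_goals simp only [Finsupp.add_apply, sum_single_one_apply]
  · intro v hv
    have hvN : v ∉ N := fun h => hNS v h (hTS v hv)
    by_cases hvx : v = x
    · subst hvx; simp [hmx, hvN]
    · simp [hvN, h5 v (by simp [hvx, hv])]
  · intro v hv
    by_cases hvx : v = x
    · subst hvx; simp [hmx, hxN]
    · have := h6 v (by simp [hvx, hv])
      have := hN2 v
      split_ifs <;> grind
  · intro v hv hvS
    have hvN : v ∉ N := fun h => hNS v h hvS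
    by_cases hvx : v = x
    · subst hvx; simp [hmx, hxN]
    · have := h7 v (by simp [hvx, hv]) (hSS' v hv hvx hvS)
      simpa [hvN] using this
  · intro v hv hvS e he hve
    have hvN : v ∉ N := fun h => hNS v h hvS
    have hvx : v ≠ x := fun h => hxM e he (h ▸ hve)
    have := h8 v (by simp [hvx, hv]) (hSS' v hv hvx hvS) e he hve
    simpa [hvN] using this

/-- Delete a vertex all of whose neighbours in `S` lie in `T`. -/
lemma HasGoodMatching.of_erase_of_forall_mem (hφ : IsEdgeFactor φ) {v : V} (hv : v ∈ U)
    (hvT : v ∉ T) (hTS : ∀ u ∈ T, u ∈ S) (hT2 : T.card ≤ 2)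
    (hS : ∀ u ∈ U, G.Adj v u → u ∈ S → u ∈ T)
    (hSS' : ∀ u ∈ U, u ≠ v → u ∈ S → u ∈ S') (hS' : ∀ u, G.Adj v u → u ∈ S')
    (h : HasGoodMatching φ G (U.erase v) S' T) : HasGoodMatching φ G U S T := by
  classical
  obtain ⟨M, m, h1, h2, h3, h4, h5, h6, h7, h8⟩ := h
  have hvM : ∀ e ∈ M, v ∉ e := fun e he hxe => by simpa using (h2 e he v hxe).1
  have hmv : m v = 0 := by
    by_contra h0
    obtain ⟨e, he, hxe⟩ := hφ.exists_mem_of_coeff_ne_zero _ v m h4 h0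
    simpa using (mem_edgesInside.mp (Finset.mem_sdiff.mp he).1).2.1 v hxe
  obtain ⟨N, hNdef⟩ : ∃ N : Finset V, ∀ u, u ∈ N ↔ u ∈ U ∧ G.Adj v u ∧ u ∉ T :=
    ⟨U.filter (fun u => G.Adj v u ∧ u ∉ T), by simp⟩
  obtain ⟨K, hKdef⟩ : ∃ K : Finset V, ∀ u, u ∈ K ↔ u ∈ U ∧ G.Adj v u ∧ u ∈ T :=
    ⟨U.filter (fun u => G.Adj v u ∧ u ∈ T), by simp⟩
  have hvN : v ∉ N := by simp [hNdef]
  have hvK : v ∉ K := by simp [hKdef]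
  have hKT : ∀ u ∈ K, u ∈ T := fun u hu => by
    simp only [hKdef] at hu
    exact hu.2.2
  have hK2 : K.card ≤ 2 := (Finset.card_le_card hKT).trans hT2
  have hNK : Disjoint N K := by
    rw [Finset.disjoint_left]
    intro u hu hu'
    simp only [hNdef] at hu
    exact hu.2.2 (hKT u hu')
  have hNS : ∀ u ∈ N, u ∉ S := by
    intro u hu huS
    simp only [hNdef] at hu
    exact hu.2.2 (hS u hu.1 hu.2.1 huS)
  have hN2 : ∀ u ∈ N, m u ≤ 2 := by
    intro u hu
    have hux : u ≠ v := fun h => hvN (h ▸ hu)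
    simp only [hNdef] at hu
    exact h7 u (by simp [hux, hu.1]) (hS' u hu.2.1)
  refine ⟨M, m + ∑ u ∈ N, Finsupp.single u 1 + Finsupp.single v K.card, h1, ?_, h3, ?_, ?_, ?_,
    ?_, ?_⟩
  · intro e he u hu
    have := h2 e he u hu
    simp only [Finset.mem_erase] at this
    tauto
  · rw [prod_edgesInside_eq (M' := M) (N := N ∪ K) hv ?_ (fun _ _ => Iff.rfl),
      Finset.erase_eq_of_notMem hvT, Finset.prod_union hNK, ← mul_assoc]
    · refine (hφ.coeff_add_single_card _ K hvK ?_).2 ((hφ.coeff_add_sum _ hmv N hvN).2 h4)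
      intro k hk
      have hkN : k ∉ N := fun h => Finset.disjoint_left.mp hNK h hk
      simp only [Finsupp.add_apply, sum_single_one_apply]
      simp [hkN, h5 k (hKT k hk)]
    · intro u
      have : s(v, u) ∉ M := fun h => hvM _ h (by simp)
      simp only [hNdef, hKdef, Finset.mem_union]
      tauto
  all_goals simp only [Finsupp.add_apply, sum_single_one_apply, Finsupp.single_apply]
  · intro u hu
    have hvu : v ≠ u := fun h => hvT (h ▸ hu)
    have huN : u ∉ N := fun h => hNS u h (hTS u hu)
    simp [huN, hvu, h5 u hu]
  · intro u hu
    by_cases huv : v = u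
    · subst huv; simp [hmv, hvN]; omega
    · have := h6 u (by simp [Ne.symm huv, hu])
      have := hN2 u
      simp only [huv, if_false]
      split_ifs <;> grind
  · intro u hu huS
    have huN : u ∉ N := fun h => hNS u h huS
    by_cases huv : v = u
    · subst huv; simpa [hmv, hvN] using hK2
    · have := h7 u (by simp [Ne.symm huv, hu]) (hSS' u hu (Ne.symm huv) huS)
      simpa [huN, huv] using this
  · intro u hu huS e he hue
    have huN : u ∉ N := fun h => hNS u h huS
    have huv : v ≠ u := fun h => hvM e he (h ▸ hue)
    have := h8 u (by simp [Ne.symm huv, hu]) (hSS' u hu (Ne.symm huv) huS) e he hue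
    simpa [huN, huv] using this

set_option maxHeartbeats 1000000 in
/-- Delete a vertex with exactly one neighbour `w` in `S \ T` and at most one in `T`. -/
lemma HasGoodMatching.of_erase_of_unique (hφ : IsEdgeFactor φ) {v w : V} (hv : v ∈ U)
    (hvT : v ∉ T) (hTS : ∀ u ∈ T, u ∈ S) (hw : w ∈ U) (hvw : G.Adj v w) (hwS : w ∈ S)
    (hwT : w ∉ T) (hT1 : ∀ u ∈ T, ∀ u' ∈ T, G.Adj v u → G.Adj v u' → u = u')
    (hS : ∀ u ∈ U, G.Adj v u → u ∈ S → u ∈ T ∨ u = w)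
    (hSS' : ∀ u ∈ U, u ≠ v → u ∈ S → u ∈ S') (hS' : ∀ u, G.Adj v u → u ∈ S')
    (h : HasGoodMatching φ G (U.erase v) S' T) : HasGoodMatching φ G U S T := by
  classical
  obtain ⟨M, m, h1, h2, h3, h4, h5, h6, h7, h8⟩ := h
  have hvM : ∀ e ∈ M, v ∉ e := fun e he hxe => by simpa using (h2 e he v hxe).1
  set Q := ∏ e ∈ edgesInside G (U.erase v) T \ M, φ e with hQdef
  have hQv : ∀ m, coeff m Q ≠ 0 → m v = 0 := by
    intro m hm
    by_contra h0
    obtain ⟨e, he, hxe⟩ := hφ.exists_mem_of_coeff_ne_zero _ v m hm h0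
    simpa using (mem_edgesInside.mp (Finset.mem_sdiff.mp he).1).2.1 v hxe
  have hmv : m v = 0 := hQv m h4
  obtain ⟨N, hNdef⟩ : ∃ N : Finset V, ∀ u, u ∈ N ↔ u ∈ U ∧ G.Adj v u ∧ u ∉ S :=
    ⟨U.filter (fun u => G.Adj v u ∧ u ∉ S), by simp⟩
  obtain ⟨K, hKdef⟩ : ∃ K : Finset V, ∀ u, u ∈ K ↔ u ∈ U ∧ G.Adj v u ∧ u ∈ T :=
    ⟨U.filter (fun u => G.Adj v u ∧ u ∈ T), by simp⟩
  have hvN : v ∉ N := by simp [hNdef]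
  have hvK : v ∉ K := by simp [hKdef]
  have hKT : ∀ u ∈ K, u ∈ T := fun u hu => by
    simp only [hKdef] at hu
    exact hu.2.2
  have hK1 : K.card ≤ 1 := Finset.card_le_one.mpr fun a ha b hb => by
    simp only [hKdef] at ha hb
    exact hT1 a ha.2.2 b hb.2.2 ha.2.1 hb.2.1
  have hNS : ∀ u ∈ N, u ∉ S := fun u hu => by
    simp only [hNdef] at hu
    exact hu.2.2
  have hNT : ∀ u ∈ N, u ∉ T := fun u hu h => hNS u hu (hTS u h)
  have hNU : ∀ u ∈ N, u ∈ U ∧ G.Adj v u := fun u hu => by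
    simp only [hNdef] at hu
    exact ⟨hu.1, hu.2.1⟩
  have hwN : w ∉ N := fun h => hNS w h hwS
  have hwK : w ∉ K := fun h => hwT (hKT w h)
  have hN2 : ∀ u ∈ N, m u ≤ 2 := fun u hu =>
    h7 u (by simp [(hNU u hu).2.ne', (hNU u hu).1]) (hS' u (hNU u hu).2)
  have hprod : ∀ (M' : Finset (Sym2 V)) (N' : Finset V), N' ⊆ N →
      (∀ e, v ∉ e → (e ∈ M' ↔ e ∈ M)) → (∀ u, s(v, u) ∈ M' ↔ u ∈ N ∧ u ∉ N') →
      ∏ e ∈ edgesInside G U T \ M', φ e =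
        Q * (∏ u ∈ N', φ s(v, u)) * φ s(v, w) * ∏ u ∈ K, φ s(v, u) := by
    intro M' N' hN' hM' hvM'
    have hd : Disjoint (insert w N') K := by
      rw [Finset.disjoint_left]
      intro u hu hu'
      rcases Finset.mem_insert.mp hu with rfl | hu
      · exact hwK hu'
      · exact hNT u (hN' hu) (hKT u hu')
    rw [prod_edgesInside_eq (M' := M) (N := insert w N' ∪ K) hv ?_ hM',
      Finset.erase_eq_of_notMem hvT, Finset.prod_union hd,
      Finset.prod_insert (fun h => hwN (hN' h))]
    · ring
    · intro u
      rw [hvM' u]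
      have h1 := hS u
      have h2 := @hN' u
      have h3 := hTS u
      have h4 := hNdef u
      have h5 := hKdef u
      simp only [Finset.mem_union, Finset.mem_insert]
      by_cases huw : u = w
      · subst huw; simp [hw, hvw, hwN, hvT]
      · grind
  have hM0 : ∀ u, s(v, u) ∈ M ↔ u ∈ N ∧ u ∉ N := fun u =>
    ⟨fun h => (hvM _ h (by simp)).elim, fun h => (h.2 h.1).elim⟩
  have hcoeff : ∀ (m' : V →₀ ℕ) (N' : Finset V), N' ⊆ N → (∀ u ∈ T, m' u = 0) →
      coeff m' Q ≠ 0 →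
      coeff (m' + ∑ u ∈ N', Finsupp.single u 1 + Finsupp.single w 1 + Finsupp.single v K.card)
        (Q * (∏ u ∈ N', φ s(v, u)) * φ s(v, w) * ∏ u ∈ K, φ s(v, u)) ≠ 0 := by
    intro m' N' hN' hT' hm'
    have hvN' : v ∉ N' := fun h => hvN (hN' h)
    refine (hφ.coeff_add_single_card _ K hvK ?_).2 ((hφ.coeff_add_single _ hvw.ne ?_).2
      ((hφ.coeff_add_sum _ (hQv m' hm') N' hvN').2 hm'))
    · intro k hk
      have hkN : k ∉ N' := fun h => hNT k (hN' h) (hKT k hk)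
      have hkw : w ≠ k := fun h => hwK (h ▸ hk)
      simp only [Finsupp.add_apply, sum_single_one_apply]
      simp [hkN, hkw, hT' k (hKT k hk)]
    · simp only [Finsupp.add_apply, sum_single_one_apply]
      simp [hvN', hQv m' hm']
  have hMU : ∀ e ∈ M, ∀ u ∈ e, u ∈ U ∧ u ∉ T := fun e he u hu => by
    have := h2 e he u hu
    simp only [Finset.mem_erase] at this
    tauto
  have hU3 : ∀ u ∈ U, v ≠ u → m u ≤ 3 := fun u hu h => h6 u (by simp [Ne.symm h, hu])
  have hU2 : ∀ u ∈ U, v ≠ u → u ∈ S → m u ≤ 2 := fun u hu h huS =>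
    h7 u (by simp [Ne.symm h, hu]) (hSS' u hu (Ne.symm h) huS)
  have hU1 : ∀ u ∈ U, u ∈ S' → ∀ e ∈ M, u ∈ e → m u ≤ 1 := fun u hu huS e he hue =>
    h8 u (by
      have : u ≠ v := fun h => hvM e he (h ▸ hue)
      simp [this, hu]) huS e he hue
  have hwS' : w ∈ S' := hS' w hvw
  by_cases hcase : m w ≤ 1 ∧ ∀ e ∈ M, w ∈ e → m w = 0
  · refine ⟨M, m + ∑ u ∈ N, Finsupp.single u 1 + Finsupp.single w 1 + Finsupp.single v K.card,
      h1, hMU, h3, ?_, ?_, ?_, ?_, ?_⟩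
    · rw [hprod M N subset_rfl (fun _ _ => Iff.rfl) hM0]
      exact hcoeff m N subset_rfl h5 h4
    all_goals simp only [Finsupp.add_apply, sum_single_one_apply, Finsupp.single_apply]
    · grind
    · grind
    · grind
    · grind
  · have hmw : 1 ≤ m w := by
      by_contra h0
      exact hcase ⟨by omega, fun _ _ _ => by omega⟩
    by_cases hc : coeff (m + ∑ u ∈ N, Finsupp.single u 1 + Finsupp.single v 1)
        (Q * (∏ u ∈ N, φ s(v, u)) * φ s(v, w)) = 0
    · have hs := hφ.coeff_shift ((hφ.coeff_add_sum Q hmv N hvN).2 h4) hc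
      have hshift : m + ∑ u ∈ N, Finsupp.single u 1 + Finsupp.single v 1 - Finsupp.single w 1 =
          m - Finsupp.single w 1 + ∑ u ∈ N, Finsupp.single u 1 + Finsupp.single v 1 := by
        ext u
        simp only [Finsupp.add_apply, Finsupp.tsub_apply, Finsupp.single_apply]
        by_cases hwu : w = u
        · subst hwu; simp; omega
        · simp [hwu]
      rw [hshift] at hs
      clear hshift
      obtain ⟨z, hzN, hz⟩ := hφ.exists_coeff_ne_zero hQv (by simp [hmv]) N hvN hs
      set m' := m - Finsupp.single w 1 + Finsupp.single z 1 with hm'def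
      have hm' : ∀ u, m' u = m u - (if w = u then 1 else 0) + (if z = u then 1 else 0) :=
        fun u => by simp [hm'def, Finsupp.single_apply]
      have hzT : z ∉ T := hNT z hzN
      have hzS' : z ∈ S' := hS' z (hNU z hzN).2
      have hT' : ∀ u ∈ T, m' u = 0 := fun u hu => by
        rw [hm' u]
        grind
      have hmv' : m' v = 0 := hQv m' hz
      by_cases hcov : ∃ e ∈ M, z ∈ e
      · have hz1 : m z ≤ 1 := by
          obtain ⟨e, he, hze⟩ := hcov
          exact hU1 z (hNU z hzN).1 hzS' e he hze
        refine ⟨M, m' + ∑ u ∈ N, Finsupp.single u 1 + Finsupp.single w 1 +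
          Finsupp.single v K.card, h1, hMU, h3, ?_, ?_, ?_, ?_, ?_⟩
        · rw [hprod M N subset_rfl (fun _ _ => Iff.rfl) hM0]
          exact hcoeff m' N subset_rfl hT' hz
        all_goals simp only [Finsupp.add_apply, sum_single_one_apply, Finsupp.single_apply, hm']
        · grind
        · grind
        · grind
        · grind
      · push Not at hcov
        refine ⟨insert s(v, z) M, m' + ∑ u ∈ N.erase z, Finsupp.single u 1 +
          Finsupp.single w 1 + Finsupp.single v K.card, ?_, ?_, ?_, ?_, ?_, ?_, ?_, ?_⟩
        · intro e he
          rcases Finset.mem_insert.mp he with rfl | he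
          · exact (hNU z hzN).2
          · exact h1 e he
        · intro e he u hu
          rcases Finset.mem_insert.mp he with rfl | he
          · rcases Sym2.mem_iff.mp hu with rfl | rfl
            · exact ⟨hv, hvT⟩
            · exact ⟨(hNU _ hzN).1, hzT⟩
          · exact hMU e he u hu
        · have hnew : ∀ e ∈ M, ∀ u ∈ e, u ∉ s(v, z) := by
            intro e he u hu hu'
            rcases Sym2.mem_iff.mp hu' with rfl | rfl
            · exact hvM e he hu
            · exact hcov e he hu
          intro e he e' he' u hu hu'
          rcases Finset.mem_insert.mp he with rfl | he <;>
            rcases Finset.mem_insert.mp he' with rfl | he'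
          · rfl
          · exact (hnew e' he' u hu' hu).elim
          · exact (hnew e he u hu hu').elim
          · exact h3 e he e' he' u hu hu'
        · rw [hprod _ (N.erase z) (Finset.erase_subset _ _)]
          · exact hcoeff m' _ (Finset.erase_subset _ _) hT' hz
          · intro e he
            have : e ≠ s(v, z) := by
              rintro rfl
              simp at he
            simp [this]
          · intro u
            have : s(v, u) ∉ M := fun h => hvM _ h (by simp)
            simp only [Finset.mem_insert, this, or_false, Sym2.congr_right, Finset.mem_erase]
            grind
        all_goals simp only [Finsupp.add_apply, sum_single_one_apply, Finsupp.single_apply, hm',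
          Finset.mem_erase]
        · grind
        · grind
        · grind
        · intro u hu huS e he hue
          rcases Finset.mem_insert.mp he with rfl | he
          · rcases Sym2.mem_iff.mp hue with rfl | rfl
            · grind
            · grind
          · grind
    · refine ⟨M, m + ∑ u ∈ N, Finsupp.single u 1 + Finsupp.single v 1 + Finsupp.single v K.card,
        h1, hMU, h3, ?_, ?_, ?_, ?_, ?_⟩
      · rw [hprod M N subset_rfl (fun _ _ => Iff.rfl) hM0]
        refine (hφ.coeff_add_single_card _ K hvK fun k hk => ?_).2 hc
        have hkN : k ∉ N := fun h => hNT k h (hKT k hk)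
        have hkv : v ≠ k := fun h => hvK (h ▸ hk)
        simp only [Finsupp.add_apply, sum_single_one_apply]
        simp [hkN, hkv, h5 k (hKT k hk)]
      all_goals simp only [Finsupp.add_apply, sum_single_one_apply, Finsupp.single_apply]
      · grind
      · grind
      · grind
      · grind

/-- Glue two good matchings along an edge. -/
lemma HasGoodMatching.union (hφ : IsEdgeFactor φ) {U₁ U₂ : Finset V} {a b : V}
    (hU : U₁ ∪ U₂ = U) (hab : ∀ u, u ∈ U₁ ∧ u ∈ U₂ ↔ u = a ∨ u = b) (hT : T ⊆ U₁)
    (hsep : ∀ u ∈ U₁, ∀ w ∈ U₂, G.Adj u w → u ∈ U₂ ∨ w ∈ U₁)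
    (h₁ : HasGoodMatching φ G U₁ S T) (h₂ : HasGoodMatching φ G U₂ S {a, b}) :
    HasGoodMatching φ G U S T := by
  obtain ⟨M, m, h1, h2, h3, h4, h5, h6, h7, h8⟩ := h₁
  obtain ⟨M', m', h1', h2', h3', h4', h5', h6', h7', h8'⟩ := h₂
  have hm'1 : ∀ u ∈ U₁, m' u = 0 := by
    intro u hu
    by_contra h0
    obtain ⟨e, he, hue⟩ := hφ.exists_mem_of_coeff_ne_zero _ u m' h4' h0
    have hu2 := (mem_edgesInside.mp (Finset.mem_sdiff.mp he).1).2.1 u hue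
    exact h0 (h5' u (by simpa using (hab u).mp ⟨hu, hu2⟩))
  have hm2 : ∀ u, u ∉ U₁ → m u = 0 := by
    intro u hu
    by_contra h0
    obtain ⟨e, he, hue⟩ := hφ.exists_mem_of_coeff_ne_zero _ u m h4 h0
    exact hu ((mem_edgesInside.mp (Finset.mem_sdiff.mp he).1).2.1 u hue)
  have hM'1 : ∀ e ∈ M', ∀ u ∈ e, u ∉ U₁ := fun e he u hu hu1 =>
    (h2' e he u hu).2 (by simpa using (hab u).mp ⟨hu1, (h2' e he u hu).1⟩)
  have hEdge : edgesInside G U T \ (M ∪ M') =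
      (edgesInside G U₁ T \ M) ∪ (edgesInside G U₂ {a, b} \ M') := by
    subst hU
    ext e
    simp only [Finset.mem_sdiff, Finset.mem_union, mem_edgesInside, not_or]
    constructor
    · rintro ⟨⟨he, hU, hT'⟩, hM, hM'⟩
      by_cases heU₁ : ∀ u ∈ e, u ∈ U₁
      · exact Or.inl ⟨⟨he, heU₁, hT'⟩, hM⟩
      · push Not at heU₁
        obtain ⟨p, hp, hp1⟩ := heU₁
        obtain ⟨q, rfl⟩ := Sym2.mem_iff_exists.mp hp
        have hp2 : p ∈ U₂ := (hU p hp).resolve_left hp1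
        have hq2 : q ∈ U₂ := by
          by_contra hq2
          have hq1 := (hU q (by simp)).resolve_right hq2
          rcases hsep q hq1 p hp2 (SimpleGraph.Adj.symm he) with h | h
          · exact hq2 h
          · exact hp1 h
        refine Or.inr ⟨⟨he, ?_, p, hp, fun h => hp1 ((hab p).mpr (by simpa using h)).1⟩, hM'⟩
        simp [hp2, hq2]
    · rintro (⟨⟨he, hU, u, hu, huT⟩, hM⟩ | ⟨⟨he, hU, u, hu, hab'⟩, hM'⟩)
      · exact ⟨⟨he, fun w hw => Or.inl (hU w hw), u, hu, huT⟩, hM,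
          fun h => hM'1 e h u hu (hU u hu)⟩
      · have hu1 : u ∉ U₁ := fun h => hab' (by simpa using (hab u).mp ⟨h, hU u hu⟩)
        exact ⟨⟨he, fun w hw => Or.inr (hU w hw), u, hu, fun h => hu1 (hT h)⟩,
          fun h => hu1 (h2 e h u hu).1, hM'⟩
  have hdisj : Disjoint (edgesInside G U₁ T \ M) (edgesInside G U₂ {a, b} \ M') := by
    rw [Finset.disjoint_left]
    intro e he he'
    obtain ⟨-, hU2, u, hu, huab⟩ := mem_edgesInside.mp (Finset.mem_sdiff.mp he').1
    exact huab (by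
      simpa using (hab u).mp
        ⟨(mem_edgesInside.mp (Finset.mem_sdiff.mp he).1).2.1 u hu, hU2 u hu⟩)
  refine ⟨M ∪ M', m + m', ?_, ?_, ?_, ?_, ?_, ?_, ?_, ?_⟩
  · intro e he
    exact (Finset.mem_union.mp he).elim (h1 e) (h1' e)
  · intro e he u hu
    subst hU
    rcases Finset.mem_union.mp he with he | he
    · exact ⟨Finset.mem_union_left _ (h2 e he u hu).1, (h2 e he u hu).2⟩
    · exact ⟨Finset.mem_union_right _ (h2' e he u hu).1, fun h => hM'1 e he u hu (hT h)⟩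
  · intro e he e' he' u hu hu'
    rcases Finset.mem_union.mp he with he | he <;> rcases Finset.mem_union.mp he' with he' | he'
    · exact h3 e he e' he' u hu hu'
    · exact (hM'1 e' he' u hu' (h2 e he u hu).1).elim
    · exact (hM'1 e he u hu (h2 e' he' u hu').1).elim
    · exact h3' e he e' he' u hu hu'
  · rw [hEdge, Finset.prod_union hdisj]
    refine hφ.coeff_mul_prod _ _ h4 h4' fun u e he hu => hm'1 u ?_
    exact (mem_edgesInside.mp (Finset.mem_sdiff.mp he).1).2.1 u hu
  all_goals simp only [Finsupp.add_apply]
  · intro u hu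
    rw [h5 u hu, hm'1 u (hT hu)]
  · grind
  · grind
  · grind

end Matching

/-! ### Finding a separating edge -/

section Separation

variable {V : Type} {G : SimpleGraph V}

/-- `C` is the interior of a connection between `q` and `r`. -/
def IsLink (G : SimpleGraph V) (C : Set V) (q r : V) : Prop :=
  C = ∅ ∧ G.Adj q r ∨
    (G.induce C).Connected ∧ (∃ c ∈ C, G.Adj q c) ∧ ∃ c ∈ C, G.Adj c r

lemma connected_induce_singleton (v : V) : (G.induce {v}).Connected := by
  have : Nonempty ({v} : Set V) := ⟨⟨v, rfl⟩⟩
  exact ⟨.of_subsingleton⟩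

lemma connected_induce_insert {C : Set V} (hC : (G.induce C).Preconnected) {q : V}
    (hq : ∃ c ∈ C, G.Adj q c) : (G.induce (insert q C)).Connected := by
  obtain ⟨c, hc, hqc⟩ := hq
  rw [Set.insert_eq]
  exact SimpleGraph.connected_induce_union (connected_induce_singleton q).preconnected hC
    rfl hc hqc

lemma preconnected_induce_insert {Z : Set V} (hZ : (G.induce Z).Preconnected) {v : V}
    (hv : ∃ z ∈ Z, G.Adj z v) : (G.induce (insert v Z)).Preconnected :=
  (connected_induce_insert hZ (hv.imp fun _ h => ⟨h.1, h.2.symm⟩)).preconnected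

lemma IsLink.connected_insert {C : Set V} {q r : V} (h : IsLink G C q r) :
    (G.induce (insert q C)).Connected := by
  obtain ⟨rfl, -⟩ | ⟨hC, hq, -⟩ := h
  · rw [insert_empty_eq]
    exact connected_induce_singleton q
  · exact connected_induce_insert hC.preconnected hq

lemma IsLink.exists_adj {C : Set V} {q r : V} (h : IsLink G C q r) :
    ∃ c ∈ insert q C, G.Adj c r := by
  obtain ⟨-, h⟩ | ⟨-, -, c, hc, h⟩ := h
  · exact ⟨q, by simp, h⟩
  · exact ⟨c, by simp [hc], h⟩

/-- Reachability inside a set of vertices. -/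
def JoinedWithin (G : SimpleGraph V) (B : Set V) : V → V → Prop :=
  Relation.ReflTransGen fun a b => G.Adj a b ∧ a ∈ B ∧ b ∈ B

lemma JoinedWithin.exists_isLink {B : Set V} {q r : V} (h : JoinedWithin G B q r) (hqr : q ≠ r) :
    ∃ C ⊆ B \ {q, r}, IsLink G C q r := by
  have key : ∀ s, JoinedWithin G B s r → (∃ C ⊆ B \ {q, r}, IsLink G C q r) ∨
      s ≠ q ∧ (s = r ∨ ∃ C ⊆ B \ {q, r}, (G.induce C).Connected ∧ s ∈ C ∧
        ∃ c ∈ C, G.Adj c r) := by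
    intro s hs
    induction hs using Relation.ReflTransGen.head_induction_on with
    | refl => exact Or.inr ⟨hqr.symm, Or.inl rfl⟩
    | @head s t hst _ ih =>
      obtain ⟨hadj, hsB, -⟩ := hst
      rcases ih with h | ⟨htq, ht⟩
      · exact Or.inl h
      by_cases hsq : s = q
      · subst hsq
        obtain rfl | ⟨C, hCB, hC, htC, hCr⟩ := ht
        · exact Or.inl ⟨∅, by simp, Or.inl ⟨rfl, hadj⟩⟩
        · exact Or.inl ⟨C, hCB, Or.inr ⟨hC, ⟨t, htC, hadj⟩, hCr⟩⟩
      refine Or.inr ⟨hsq, ?_⟩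
      by_cases hsr : s = r
      · exact Or.inl hsr
      have hsB' : s ∈ B \ {q, r} := ⟨hsB, by simp [hsq, hsr]⟩
      obtain rfl | ⟨C, hCB, hC, htC, c, hc, hcr⟩ := ht
      · exact Or.inr ⟨{s}, by simpa using hsB', connected_induce_singleton s, rfl, s, rfl, hadj⟩
      · exact Or.inr ⟨insert s C, Set.insert_subset hsB' hCB,
          connected_induce_insert hC.preconnected ⟨t, htC, hadj⟩, by simp, c, by simp [hc], hcr⟩
  exact (key q h).resolve_right fun h => h.1 rfl

lemma isMinorOf_of_links_inter {Z C D : Set V} {v p q r : V} (hZ : (G.induce Z).Connected)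
    (hvp : G.Adj v p) (hvq : G.Adj v q) (hvr : G.Adj v r) (hpq : p ≠ q) (hqr : q ≠ r) (hpr : p ≠ r)
    (hp : ∃ z ∈ Z, G.Adj z p) (hq : ∃ z ∈ Z, G.Adj z q) (hr : ∃ z ∈ Z, G.Adj z r)
    (hC : IsLink G C p q) (hD : IsLink G D q r) (hCD : (C ∩ D).Nonempty)
    (hdis : ∀ u, u = v ∨ u = p ∨ u = q ∨ u = r → u ∉ Z ∧ u ∉ C ∧ u ∉ D)
    (hZCD : Disjoint Z (C ∪ D)) :
    (completeBipartiteGraph (Fin 3) (Fin 3)).IsMinorOf G := by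
  obtain ⟨a, haC, haD⟩ := hCD
  obtain ⟨rfl, -⟩ | ⟨hCc, ⟨c, hc, hpc⟩, c', hc', hqc⟩ := hC
  · simp at haC
  obtain ⟨rfl, -⟩ | ⟨hDc, -, d, hd, hrd⟩ := hD
  · simp at haD
  have hE : (G.induce (C ∪ D)).Connected :=
    SimpleGraph.induce_union_connected hCc.preconnected hDc.preconnected ⟨a, haC, haD⟩
  have hv := hdis v (by simp)
  have hp' := hdis p (by simp)
  have hq' := hdis q (by simp)
  have hr' := hdis r (by simp)
  have hvpne := hvp.ne
  have hvqne := hvq.ne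
  have hvrne := hvr.ne
  have hadj : ∀ i j : Fin 3, ∃ a ∈ (![{v}, Z, C ∪ D] : Fin 3 → Set V) i,
      G.Adj a ((![p, q, r] : Fin 3 → V) j) := by
    intro i j
    fin_cases i
    · fin_cases j <;> simpa
    · fin_cases j <;> simpa
    · fin_cases j
      · exact ⟨c, Or.inl hc, hpc.symm⟩
      · exact ⟨c', Or.inl hc', hqc⟩
      · exact ⟨d, Or.inr hd, hrd⟩
  have hconn : ∀ i : Fin 3, (G.induce ((![{v}, Z, C ∪ D] : Fin 3 → Set V) i)).Connected := by
    intro i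
    fin_cases i
    exacts [connected_induce_singleton v, hZ, hE]
  refine ⟨Sum.elim ![{v}, Z, C ∪ D] fun j => {(![p, q, r] : Fin 3 → V) j}, ?_, ?_, ?_, ?_⟩
  · rintro (i | j)
    · exact Set.nonempty_coe_sort.mp (hconn i).nonempty
    · exact Set.singleton_nonempty _
  · rintro (i | j)
    · exact hconn i
    · exact connected_induce_singleton _
  · rw [Set.disjoint_union_right] at hZCD
    rintro (i | i) (j | j) hij <;> fin_cases i <;> fin_cases j <;>
      simp_all [Set.disjoint_union_right, disjoint_comm, ne_comm]
  · rintro (i | j) (i' | j') h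
    · simp at h
    · obtain ⟨a, ha, h⟩ := hadj i j'
      exact ⟨a, ha, _, rfl, h⟩
    · obtain ⟨a, ha, h⟩ := hadj i' j
      exact ⟨_, rfl, a, ha, h.symm⟩
    · simp at h

lemma isMinorOf_of_links_disjoint {Z C D E : Set V} {v p q r : V} (hZ : (G.induce Z).Connected)
    (hvp : G.Adj v p) (hvq : G.Adj v q) (hvr : G.Adj v r) (hpq : p ≠ q) (hqr : q ≠ r) (hpr : p ≠ r)
    (hv : ∃ z ∈ Z, G.Adj z v)
    (hp : ∃ z ∈ Z, G.Adj z p) (hq : ∃ z ∈ Z, G.Adj z q) (hr : ∃ z ∈ Z, G.Adj z r)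
    (hC : IsLink G C p q) (hD : IsLink G D q r) (hE : IsLink G E r p)
    (hCD : Disjoint C D) (hDE : Disjoint D E) (hCE : Disjoint C E)
    (hdis : ∀ u, u = v ∨ u = p ∨ u = q ∨ u = r → u ∉ Z ∧ u ∉ C ∧ u ∉ D ∧ u ∉ E)
    (hZC : Disjoint Z C) (hZD : Disjoint Z D) (hZE : Disjoint Z E) :
    (SimpleGraph.completeGraph (Fin 5)).IsMinorOf G := by
  have hv' := hdis v (by simp)
  have hp' := hdis p (by simp)
  have hq' := hdis q (by simp)
  have hr' := hdis r (by simp)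
  have hvpne := hvp.ne
  have hvqne := hvq.ne
  have hvrne := hvr.ne
  have hpq' := hC.exists_adj
  have hqr' := hD.exists_adj
  have hrp' := hE.exists_adj
  set B : Fin 5 → Set V := ![Z, {v}, insert p C, insert q D, insert r E] with hB
  have hconn : ∀ i, (G.induce (B i)).Connected := by
    intro i
    fin_cases i
    exacts [hZ, connected_induce_singleton v, hC.connected_insert, hD.connected_insert,
      hE.connected_insert]
  have hdisj : ∀ i j, i < j → Disjoint (B i) (B j) := by
    intro i j hij
    fin_cases i <;> fin_cases j <;> simp_all [disjoint_comm, ne_comm]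
  have hadj : ∀ i j, i < j → ∃ a ∈ B i, ∃ b ∈ B j, G.Adj a b := by
    have hlink : ∀ {C D : Set V} {y : V}, (∃ c ∈ C, G.Adj c y) →
        ∃ a ∈ C, ∃ b ∈ insert y D, G.Adj a b := fun ⟨c, hc, h⟩ => ⟨c, hc, _, by simp, h⟩
    intro i j hij
    fin_cases i <;> fin_cases j <;> try exact absurd hij (by decide)
    · obtain ⟨z, hz, h⟩ := hv
      exact ⟨z, hz, v, rfl, h⟩
    · exact hlink hp
    · exact hlink hq
    · exact hlink hr
    · exact hlink ⟨v, rfl, hvp⟩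
    · exact hlink ⟨v, rfl, hvq⟩
    · exact hlink ⟨v, rfl, hvr⟩
    · exact hlink hpq'
    · obtain ⟨c, hc, h⟩ := hrp'
      exact ⟨p, by simp [hB], c, hc, h.symm⟩
    · exact hlink hqr'
  refine ⟨B, fun i => Set.nonempty_coe_sort.mp (hconn i).nonempty, hconn, ?_, ?_⟩
  · intro i j hij
    rcases hij.lt_or_gt with h | h
    · exact hdisj i j h
    · exact (hdisj j i h).symm
  · intro i j hij
    rcases hij.ne.lt_or_gt with h | h
    · exact hadj i j h
    · obtain ⟨a, ha, b, hb, h⟩ := hadj j i h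
      exact ⟨b, hb, a, ha, h.symm⟩

/-- If `v` and three of its neighbours are adjacent to a connected set `Z` in a planar graph, then
`v` and one of these neighbours separate the other two outside `Z`. -/
lemma SimpleGraph.Planar.not_joinedWithin (hG : G.Planar) {Z U : Set V}
    (hZ : (G.induce Z).Preconnected) (hZU : Disjoint Z U) {v p q r : V}
    (hvU : v ∈ U) (hpU : p ∈ U) (hqU : q ∈ U) (hrU : r ∈ U)
    (hvp : G.Adj v p) (hvq : G.Adj v q) (hvr : G.Adj v r) (hpq : p ≠ q) (hqr : q ≠ r) (hpr : p ≠ r)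
    (hv : ∃ z ∈ Z, G.Adj z v)
    (hp : ∃ z ∈ Z, G.Adj z p) (hq : ∃ z ∈ Z, G.Adj z q) (hr : ∃ z ∈ Z, G.Adj z r)
    (h₁ : JoinedWithin G (U \ {v, r}) p q) (h₂ : JoinedWithin G (U \ {v, p}) q r) :
    ¬ JoinedWithin G (U \ {v, q}) r p := by
  intro h₃
  have hZ' : (G.induce Z).Connected := by
    obtain ⟨z, hz, -⟩ := hv
    have : Nonempty Z := ⟨⟨z, hz⟩⟩
    exact ⟨hZ⟩
  obtain ⟨C, hCU, hC⟩ := h₁.exists_isLink hpq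
  obtain ⟨D, hDU, hD⟩ := h₂.exists_isLink hqr
  obtain ⟨E, hEU, hE⟩ := h₃.exists_isLink hpr.symm
  have hZC : Disjoint Z C := hZU.mono_right fun u hu => (hCU hu).1.1
  have hZD : Disjoint Z D := hZU.mono_right fun u hu => (hDU hu).1.1
  have hZE : Disjoint Z E := hZU.mono_right fun u hu => (hEU hu).1.1
  have hdis : ∀ u, u = v ∨ u = p ∨ u = q ∨ u = r → u ∉ Z ∧ u ∉ C ∧ u ∉ D ∧ u ∉ E := by
    intro u hu
    have hC' := @hCU u
    have hD' := @hDU u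
    have hE' := @hEU u
    have hZ'' : u ∉ Z := fun h => Set.disjoint_left.mp hZU h (by grind)
    simp only [Set.mem_sdiff, Set.mem_insert_iff, Set.mem_singleton_iff] at hC' hD' hE'
    grind
  by_cases hCD : Disjoint C D
  · by_cases hDE : Disjoint D E
    · by_cases hCE : Disjoint C E
      · exact hG.1 (isMinorOf_of_links_disjoint hZ' hvp hvq hvr hpq hqr hpr hv hp hq hr hC hD hE
          hCD hDE hCE hdis hZC hZD hZE)
      · exact hG.2 (isMinorOf_of_links_inter hZ' hvr hvp hvq hpr.symm hpq hqr.symm hr hp hq hE hC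
          (Set.not_disjoint_iff_nonempty_inter.mp fun h => hCE h.symm)
          (fun u hu => by grind) (Set.disjoint_union_right.mpr ⟨hZE, hZC⟩))
    · exact hG.2 (isMinorOf_of_links_inter hZ' hvq hvr hvp hqr hpr.symm hpq.symm hq hr hp hD hE
          (Set.not_disjoint_iff_nonempty_inter.mp hDE)
          (fun u hu => by grind) (Set.disjoint_union_right.mpr ⟨hZD, hZE⟩))
  · exact hG.2 (isMinorOf_of_links_inter hZ' hvp hvq hvr hpq hqr hpr hp hq hr hC hD
      (Set.not_disjoint_iff_nonempty_inter.mp hCD)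
      (fun u hu => by grind) (Set.disjoint_union_right.mpr ⟨hZC, hZD⟩))

end Separation

/-! ### Constructing the matching -/

section Construction

variable {V : Type} [DecidableEq V] {φ : Sym2 V → MvPolynomial V ℤ}
  {G : SimpleGraph V} {U T : Finset V}

lemma exists_separation {a b q r : V} (ha : a ∈ U) (hb : b ∈ U) (hq : q ∈ U) (hqa : q ≠ a)
    (hqb : q ≠ b) (hr : r ∈ U) (hra : r ≠ a) (hrb : r ≠ b)
    (hqr : ¬ JoinedWithin G (U \ {a, b}) q r) (hTU : T ⊆ U) (hT : G.IsClique T) :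
    ∃ U₁ U₂ : Finset V, U₁ ∪ U₂ = U ∧ (∀ u, u ∈ U₁ ∧ u ∈ U₂ ↔ u = a ∨ u = b) ∧ T ⊆ U₁ ∧
      (∀ u ∈ U₁, ∀ w ∈ U₂, G.Adj u w → u ∈ U₂ ∨ w ∈ U₁) ∧
      U₁.card < U.card ∧ U₂.card < U.card := by
  classical
  obtain ⟨C, hC⟩ : ∃ C : Finset V, ∀ u, u ∈ C ↔
      u ∈ U ∧ u ≠ a ∧ u ≠ b ∧ JoinedWithin G (U \ {a, b}) q u :=
    ⟨U.filter fun u => u ≠ a ∧ u ≠ b ∧ JoinedWithin G (U \ {a, b}) q u, by simp⟩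
  have hclosed : ∀ u ∈ C, ∀ w ∈ U, w ≠ a → w ≠ b → G.Adj u w → w ∈ C := by
    intro u hu w hw hwa hwb huw
    have hu' := (hC u).mp hu
    exact (hC w).mpr ⟨hw, hwa, hwb, hu'.2.2.2.tail
      ⟨huw, ⟨hu'.1, by simp [hu'.2.1, hu'.2.2.1]⟩, ⟨hw, by simp [hwa, hwb]⟩⟩⟩
  have hqC : q ∈ C := (hC q).mpr ⟨hq, hqa, hqb, .refl⟩
  have hrC : r ∉ C := fun h => hqr ((hC r).mp h).2.2.2
  have hCU : ∀ u ∈ C, u ∈ U ∧ u ≠ a ∧ u ≠ b := fun u hu =>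
    ⟨((hC u).mp hu).1, ((hC u).mp hu).2.1, ((hC u).mp hu).2.2.1⟩
  clear hC hqr
  have hAcard : (insert a (insert b C)).card < U.card :=
    Finset.card_lt_card ((Finset.ssubset_iff_of_subset (by grind)).mpr ⟨r, hr, by grind⟩)
  have hBcard : (U \ C).card < U.card :=
    Finset.card_lt_card ((Finset.ssubset_iff_of_subset (by grind)).mpr ⟨q, hq, by grind⟩)
  by_cases hTC : ∃ t ∈ T, t ∈ C
  · obtain ⟨t, htT, htC⟩ := hTC
    refine ⟨insert a (insert b C), U \ C, by grind, by grind, ?_, by grind, hAcard, hBcard⟩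
    intro u hu
    by_cases htu : t = u
    · grind
    · have := hclosed t htC u (hTU hu)
      have := hT htT hu htu
      grind
  · refine ⟨U \ C, insert a (insert b C), by grind, by grind, by grind, ?_, hBcard, hAcard⟩
    intro u hu w hw huw
    have := huw.symm
    grind

variable [Fintype V]

/-- Induction statement: the vertices adjacent to the removed connected set `Z` are restricted. -/
def ConstructionStep (φ : Sym2 V → MvPolynomial V ℤ) (G : SimpleGraph V) (U : Finset V) : Prop :=
  ∀ (Z : Set V) (T : Finset V), (G.induce Z).Preconnected → Disjoint Z U → T ⊆ U →
    (∀ u ∈ T, ∃ z ∈ Z, G.Adj z u) → G.IsClique T → T.card ≤ 2 →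
    HasGoodMatching φ G U {u | ∃ z ∈ Z, G.Adj z u} T

lemma ConstructionStep.erase {Z : Set V} {v : V} (h : ConstructionStep φ G (U.erase v))
    (hZ : (G.induce (insert v Z)).Preconnected) (hZU : Disjoint Z U) (hTU : T ⊆ U)
    (hvT : v ∉ T) (hTS : ∀ u ∈ T, ∃ z ∈ Z, G.Adj z u) (hT : G.IsClique T) (hT2 : T.card ≤ 2) :
    HasGoodMatching φ G (U.erase v) {u | ∃ z ∈ insert v Z, G.Adj z u} T := by
  refine h _ T hZ ?_ (fun u hu => ?_) (fun u hu => ?_) hT hT2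
  · rw [Set.disjoint_left] at hZU ⊢
    rintro u (rfl | hu) hu'
    · simp at hu'
    · exact hZU hu (Finset.mem_of_mem_erase hu')
  · exact Finset.mem_erase.mpr ⟨fun h => hvT (h ▸ hu), hTU hu⟩
  · obtain ⟨z, hz, h⟩ := hTS u hu
    exact ⟨z, Or.inr hz, h⟩

lemma hasGoodMatching_pair (hφ : IsEdgeFactor φ) (hG : G.Planar)
    (ih : ∀ U' : Finset V, U'.card < U.card → ConstructionStep φ G U')
    {Z : Set V} (hZ : (G.induce Z).Preconnected) (hZU : Disjoint Z U) {x y : V} (hx : x ∈ U)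
    (hy : y ∈ U) (hxy : G.Adj x y) (hxS : ∃ z ∈ Z, G.Adj z x) (hyS : ∃ z ∈ Z, G.Adj z y) :
    HasGoodMatching φ G U {u | ∃ z ∈ Z, G.Adj z u} {x, y} := by
  have hTU : ({x, y} : Finset V) ⊆ U := by grind
  have hTS : ∀ u ∈ ({x, y} : Finset V), ∃ z ∈ Z, G.Adj z u := by
    intro u hu
    simp only [Finset.mem_insert, Finset.mem_singleton] at hu
    rcases hu with rfl | rfl <;> assumption
  have hpair : ∀ {a b : V}, G.Adj a b → G.IsClique ({a, b} : Finset V) := fun h => by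
    simpa [SimpleGraph.isClique_pair] using fun _ => h
  have hmono : ∀ v u : V, (∃ z ∈ Z, G.Adj z u) → ∃ z ∈ insert v Z, G.Adj z u :=
    fun v u ⟨z, hz, h⟩ => ⟨z, Or.inr hz, h⟩
  have hnew : ∀ v u : V, G.Adj v u → ∃ z ∈ insert v Z, G.Adj z u :=
    fun v u h => ⟨v, Or.inl rfl, h⟩
  by_cases hv : ∃ v ∈ U, (∃ z ∈ Z, G.Adj z v) ∧ v ≠ y ∧ G.Adj x v
  · obtain ⟨v, hvU, hvS, hvy, hxv⟩ := hv
    have hvT : v ∉ ({x, y} : Finset V) := by simp [hvy, hxv.ne']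
    have herase := (ih _ (Finset.card_erase_lt_of_mem hvU)).erase
      (preconnected_induce_insert hZ hvS) hZU hTU hvT hTS (hpair hxy) Finset.card_le_two
    by_cases hw : ∃ w w', w ∈ U ∧ w' ∈ U ∧ (∃ z ∈ Z, G.Adj z w) ∧ (∃ z ∈ Z, G.Adj z w') ∧
        G.Adj v w ∧ G.Adj v w' ∧ w ≠ x ∧ w' ≠ x ∧ w ≠ w'
    · obtain ⟨w, w', hwU, hwU', hwS, hwS', hvw, hvw', hwx, hwx', hww⟩ := hw
      have hsplit : ∀ p q r, p ∈ U → (∃ z ∈ Z, G.Adj z p) → G.Adj v p → q ∈ U → q ≠ v → q ≠ p →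
          r ∈ U → r ≠ v → r ≠ p → ¬ JoinedWithin G (U \ {v, p}) q r →
          HasGoodMatching φ G U {u | ∃ z ∈ Z, G.Adj z u} {x, y} := by
        intro p q r hp hpS hvp hq hqv hqp hr hrv hrp hJ
        obtain ⟨U₁, U₂, hU, hab, hT, hsep, hc₁, hc₂⟩ :=
          exists_separation hvU hp hq hqv hqp hr hrv hrp hJ hTU (hpair hxy)
        have hU₁ : (U₁ : Set V) ⊆ U := by
          rw [← hU]
          exact_mod_cast Finset.subset_union_left
        have hU₂ : (U₂ : Set V) ⊆ U := by
          rw [← hU]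
          exact_mod_cast Finset.subset_union_right
        refine HasGoodMatching.union hφ hU hab hT hsep
          (ih _ hc₁ Z _ hZ (hZU.mono_right hU₁) hT hTS (hpair hxy) Finset.card_le_two)
          (ih _ hc₂ Z _ hZ (hZU.mono_right hU₂) ?_ ?_ (hpair hvp) Finset.card_le_two)
        · intro u hu
          exact ((hab u).mpr (by simpa using hu)).2
        · intro u hu
          simp only [Finset.mem_insert, Finset.mem_singleton] at hu
          rcases hu with rfl | rfl <;> assumption
      by_cases h₁ : JoinedWithin G (U \ {v, w'}) x w
      · by_cases h₂ : JoinedWithin G (U \ {v, x}) w w'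
        · exact hsplit w w' x hwU hwS hvw hwU' hvw'.ne' hww.symm hx hxv.ne hwx.symm
            (hG.not_joinedWithin hZ hZU hvU hx hwU hwU' hxv.symm hvw hvw' hwx.symm hww hwx'.symm
              hvS hxS hwS hwS' h₁ h₂)
        · exact hsplit x w w' hx hxS hxv.symm hwU hvw.ne' hwx hwU' hvw'.ne' hwx' h₂
      · exact hsplit w' x w hwU' hwS' hvw' hx hxv.ne hwx'.symm hwU hvw.ne' hww h₁
    · have huniq : ∀ w w', w ∈ U → w' ∈ U → (∃ z ∈ Z, G.Adj z w) → (∃ z ∈ Z, G.Adj z w') →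
          G.Adj v w → G.Adj v w' → w ≠ x → w' ≠ x → w = w' := by
        intro w w' h1 h2 h3 h4 h5 h6 h7 h8
        by_contra h9
        exact hw ⟨w, w', h1, h2, h3, h4, h5, h6, h7, h8, h9⟩
      by_cases hsub : ∀ u ∈ U, G.Adj v u → (∃ z ∈ Z, G.Adj z u) → u ∈ ({x, y} : Finset V)
      · exact herase.of_erase_of_forall_mem hφ hvU hvT hTS Finset.card_le_two hsub
          (fun u _ _ => hmono v u) (hnew v)
      · push Not at hsub
        obtain ⟨w, hwU, hvw, hwS, hwT⟩ := hsub
        have hwx : w ≠ x := by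
          rintro rfl
          simp at hwT
        have hyv : ¬ G.Adj v y := fun h => by
          have := huniq y w hy hwU hyS hwS h hvw hxy.ne' hwx
          simp [this] at hwT
        refine herase.of_erase_of_unique hφ hvU hvT hTS hwU hvw hwS hwT ?_ ?_
          (fun u _ _ => hmono v u) (hnew v)
        · intro u hu u' hu' h h'
          simp only [Finset.mem_insert, Finset.mem_singleton] at hu hu'
          grind
        · intro u hu hvu huS
          by_cases hux : u = x
          · simp [hux]
          · exact Or.inr (huniq u w hu hwU huS hwS hvu hvw hux hwx)
  · push Not at hv
    have hT : ({x, y} : Finset V).erase x = {y} := by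
      rw [Finset.erase_insert]
      simpa using hxy.ne
    refine HasGoodMatching.of_erase hφ hx hTS (Or.inl (by simp)) (fun u hu hxu huS => ?_)
      (fun u _ _ => hmono x u) (hnew x) ?_
    · by_contra h
      exact hv u hu huS (fun h' => h (by simp [h'])) hxu
    · rw [hT]
      exact (ih _ (Finset.card_erase_lt_of_mem hx)).erase (preconnected_induce_insert hZ hxS)
        hZU (by simpa using hy) (by simpa using hxy.ne) (by simpa using hyS) (by simp) (by simp)

lemma hasGoodMatching_singleton (hφ : IsEdgeFactor φ) (hG : G.Planar)
    (ih : ∀ U' : Finset V, U'.card < U.card → ConstructionStep φ G U')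
    {Z : Set V} (hZ : (G.induce Z).Preconnected) (hZU : Disjoint Z U) {x : V} (hx : x ∈ U)
    (hxS : ∃ z ∈ Z, G.Adj z x) :
    HasGoodMatching φ G U {u | ∃ z ∈ Z, G.Adj z u} {x} := by
  by_cases hy : ∃ y ∈ U, G.Adj x y ∧ ∃ z ∈ Z, G.Adj z y
  · obtain ⟨y, hyU, hxy, hyS⟩ := hy
    exact (hasGoodMatching_pair hφ hG ih hZ hZU hx hyU hxy hxS hyS).of_pair hφ hxy hx hyU
  · refine HasGoodMatching.of_erase hφ hx (by simpa using hxS) (Or.inl (by simp))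
      (fun u hu hxu huS => (hy ⟨u, hu, hxu, huS⟩).elim)
      (S' := {u | ∃ z ∈ insert x Z, G.Adj z u})
      (fun u _ _ ⟨z, hz, h⟩ => ⟨z, Or.inr hz, h⟩) (fun u h => ⟨x, Or.inl rfl, h⟩) ?_
    rw [Finset.erase_singleton]
    exact (ih _ (Finset.card_erase_lt_of_mem hx)).erase (preconnected_induce_insert hZ hxS)
      hZU (by simp) (by simp) (by simp) (by simp) (by simp)

lemma hasGoodMatching_of_empty (hφ : IsEdgeFactor φ) (hG : G.Planar)
    (ih : ∀ U' : Finset V, U'.card < U.card → ConstructionStep φ G U')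
    {Z : Set V} (hZ : (G.induce Z).Preconnected) (hZU : Disjoint Z U) :
    HasGoodMatching φ G U {u | ∃ z ∈ Z, G.Adj z u} ∅ := by
  by_cases hx : ∃ x ∈ U, ∃ z ∈ Z, G.Adj z x
  · obtain ⟨x, hxU, hxS⟩ := hx
    exact (hasGoodMatching_singleton hφ hG ih hZ hZU hxU hxS).of_singleton
  obtain rfl | ⟨x, hxU⟩ := U.eq_empty_or_nonempty
  · exact hasGoodMatching_empty
  refine HasGoodMatching.of_erase hφ hxU (by simp) (Or.inr rfl)
    (fun u hu _ huS => (hx ⟨u, hu, huS⟩).elim) (S' := {u | ∃ z ∈ insert x (∅ : Set V), G.Adj z u})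
    (fun u hu _ huS => (hx ⟨u, hu, huS⟩).elim) (fun u h => ⟨x, Or.inl rfl, h⟩) ?_
  rw [Finset.erase_empty]
  refine (ih _ (Finset.card_erase_lt_of_mem hxU)).erase ?_ (by simp) (by simp) (by simp) (by simp)
    (by simp) (by simp)
  rw [insert_empty_eq]
  exact (connected_induce_singleton x).preconnected

lemma constructionStep (hφ : IsEdgeFactor φ) (hG : G.Planar) (U : Finset V) :
    ConstructionStep φ G U := by
  induction h : U.card using Nat.strong_induction_on generalizing U with
  | _ n ih =>
    subst h
    replace ih : ∀ U' : Finset V, U'.card < U.card → ConstructionStep φ G U' :=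
      fun U' h => ih _ h U' rfl
    intro Z T hZ hZU hTU hTS hT hT2
    have hcard : T.card = 0 ∨ T.card = 1 ∨ T.card = 2 := by omega
    rcases hcard with h | h | h
    · rw [Finset.card_eq_zero.mp h]
      exact hasGoodMatching_of_empty hφ hG ih hZ hZU
    · obtain ⟨x, rfl⟩ := Finset.card_eq_one.mp h
      exact hasGoodMatching_singleton hφ hG ih hZ hZU (hTU (by simp)) (hTS x (by simp))
    · obtain ⟨x, y, hxy, rfl⟩ := Finset.card_eq_two.mp h
      exact hasGoodMatching_pair hφ hG ih hZ hZU (hTU (by simp)) (hTU (by simp))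
        (hT (by simp) (by simp) hxy) (hTS x (by simp)) (hTS y (by simp))

end Construction

/-- Grytczuk–Zhu: every planar graph `G` contains a matching `𝓜` (given by its edges
`s(r i, g i)`) such that the graph polynomial of `G - 𝓜` has a nonvanishing monomial of
degree at most `3` in every variable (so the Alon–Tarsi number of `G - 𝓜` is at most `4`). -/
theorem stmt6 {V : Type} [Fintype V] [DecidableEq V] [LinearOrder V]
    (G : SimpleGraph V) (hG : G.Planar) :
    ∃ (n : ℕ) (r g : Fin n → V),
      (∀ i, G.Adj (r i) (g i)) ∧
      Function.Injective (Sum.elim r g) ∧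
      ∃ m : V →₀ ℕ,
        MvPolynomial.coeff m (graphPoly (G.deleteEdges {e | ∃ i, e = s(r i, g i)})) ≠ 0 ∧
        ∀ v : V, m v ≤ 3 := by
  classical
  set φ : Sym2 V → MvPolynomial V ℤ :=
    Sym2.lift ⟨fun a b => (X (min a b) : MvPolynomial V ℤ) - X (max a b),
      fun a b => by simp only [min_comm a b, max_comm a b]⟩ with hφdef
  have hφ : IsEdgeFactor φ := by
    intro a b
    rcases le_total a b with h | h <;> simp [hφdef, h]
  obtain ⟨M, m, h1, -, h3, h4, -, h6, -, -⟩ := constructionStep hφ hG Finset.univ ∅ ∅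
    (SimpleGraph.Preconnected.of_subsingleton) (by simp) (by simp) (by simp) (by simp) (by simp)
  set E : Fin M.card → Sym2 V := fun i => M.equivFin.symm i with hE
  have hEM : ∀ i, E i ∈ M := fun i => (M.equivFin.symm i).2
  have hEinj : Function.Injective E := Subtype.val_injective.comp M.equivFin.symm.injective
  have hEsurj : ∀ e ∈ M, ∃ i, e = E i := fun e he => ⟨M.equivFin ⟨e, he⟩, by simp [hE]⟩
  have hout : ∀ e : Sym2 V, s((Quot.out e).1, (Quot.out e).2) = e := fun e => Quot.out_eq e
  have hadj : ∀ i, G.Adj (Quot.out (E i)).1 (Quot.out (E i)).2 := fun i => by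
    rw [← SimpleGraph.mem_edgeSet, hout]
    exact h1 _ (hEM i)
  have hfst : ∀ e : Sym2 V, (Quot.out e).1 ∈ e := Sym2.out_fst_mem
  have hsnd : ∀ e : Sym2 V, (Quot.out e).2 ∈ e := Sym2.out_snd_mem
  have hsame : ∀ i j v, v ∈ E i → v ∈ E j → i = j := fun i j v hi hj =>
    hEinj (h3 _ (hEM i) _ (hEM j) v hi hj)
  refine ⟨M.card, fun i => (Quot.out (E i)).1, fun i => (Quot.out (E i)).2, hadj, ?_, m, ?_,
    fun v => h6 v (Finset.mem_univ v)⟩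
  · rintro (i | i) (j | j) h <;> simp only [Sum.elim_inl, Sum.elim_inr] at h
    · rw [hsame i j _ (hfst _) (h ▸ hfst _)]
    · obtain rfl := hsame i j _ (hfst _) (h ▸ hsnd _)
      exact ((hadj i).ne h).elim
    · obtain rfl := hsame i j _ (hsnd _) (h ▸ hfst _)
      exact ((hadj i).ne h.symm).elim
    · rw [hsame i j _ (hsnd _) (h ▸ hsnd _)]
  · unfold graphPoly
    convert h4 using 3
    ext e
    rw [@SimpleGraph.mem_edgeFinset _ _ _ (Fintype.ofFinite _),
      SimpleGraph.edgeSet_deleteEdges, Finset.mem_sdiff, mem_edgesInside, Set.mem_sdiff]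
    have hM : (∃ i, e = s((Quot.out (E i)).1, (Quot.out (E i)).2)) ↔ e ∈ M := by
      simp only [hout]
      exact ⟨fun ⟨i, h⟩ => h ▸ hEM i, hEsurj e⟩
    have hex : ∃ v, v ∈ e := ⟨_, hfst e⟩
    simp [hM, hex]
end

section
/- Every planar graph G contains a matching 𝓜 such that the graph G − 𝓜 is 4-choosable. -/
/-- A graph is `k`-choosable if for every assignment of a list of at least `k` colors to
each vertex there is a proper coloring choosing each vertex's color from its own list. -/
def SimpleGraph.Choosable {V : Type} (G : SimpleGraph V) (k : ℕ) : Prop :=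
  ∀ L : V → Finset ℕ, (∀ v, k ≤ (L v).card) →
    ∃ c : V → ℕ, (∀ v, c v ∈ L v) ∧ ∀ ⦃u w : V⦄, G.Adj u w → c u ≠ c w

namespace SimpleGraph

section Separation

variable {V : Type} {G : SimpleGraph V}

lemma Preconnected.induce_insert {s : Set V} (hs : (G.induce s).Preconnected) {u v : V}
    (hu : u ∈ s) (huv : G.Adj u v) : (G.induce (insert v s)).Connected := by
  have h := induce_union_connected (induce_pair_connected_of_adj huv).preconnected hs
    ⟨u, by simp, hu⟩
  have he : ({u, v} : Set V) ∪ s = insert v s := by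
    ext w
    simp only [Set.mem_union, Set.mem_insert_iff, Set.mem_singleton_iff]
    constructor
    · rintro ((rfl | rfl) | h)
      · exact Or.inr hu
      · exact Or.inl rfl
      · exact Or.inr h
    · rintro (rfl | h)
      · exact Or.inl (Or.inr rfl)
      · exact Or.inr h
  rwa [he] at h

lemma induce_singleton_connected (v : V) : (G.induce ({v} : Set V)).Connected := by
  simp

/-- `D` is the vertex set of a connected component of `G.induce X`. -/
structure IsComponentIn (G : SimpleGraph V) (X D : Set V) : Prop where
  subset : D ⊆ X
  connected : (G.induce D).Connected
  closed : ∀ q ∈ D, ∀ r ∈ X, G.Adj q r → r ∈ D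

lemma exists_isComponentIn {X : Set V} {p : V} (hp : p ∈ X) :
    ∃ D, G.IsComponentIn X D ∧ p ∈ D := by
  let S : Set (Set V) := {A | A ⊆ X ∧ p ∈ A ∧ (G.induce A).Connected}
  have hpS : {p} ∈ S := ⟨by simpa using hp, rfl, induce_singleton_connected p⟩
  refine ⟨⋃₀ S, ⟨Set.sUnion_subset fun A hA => hA.1, ?_, ?_⟩, _, hpS, rfl⟩
  · exact induce_sUnion_connected_of_pairwise_not_disjoint ⟨_, hpS⟩
      (fun hs ht => ⟨p, hs.2.1, ht.2.1⟩) (fun hs => hs.2.2)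
  · rintro q ⟨A, hA, hq⟩ r hr hqr
    exact ⟨insert r A, ⟨Set.insert_subset hr hA.1, Or.inr hA.2.1,
      hA.2.2.preconnected.induce_insert hq hqr⟩, Or.inl rfl⟩

lemma Preconnected.induce_subset_of_closed {A D : Set V} (hA : (G.induce A).Preconnected)
    (hD : ∀ q ∈ D, ∀ r ∈ A, G.Adj q r → r ∈ D) {p : V} (hpA : p ∈ A) (hpD : p ∈ D) : A ⊆ D := by
  have key : ∀ (x y : A), (G.induce A).Walk x y → x.1 ∈ D → y.1 ∈ D := by
    intro x y w
    induction w with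
    | nil => exact id
    | cons h _ ih => exact fun hx => ih (hD _ hx _ (Subtype.property _) h)
  intro q hq
  obtain ⟨w⟩ := hA ⟨p, hpA⟩ ⟨q, hq⟩
  exact key _ _ w hpD

lemma IsComponentIn.eq_of_mem {X D E : Set V} (h : G.IsComponentIn X D)
    (hE : G.IsComponentIn X E) {p : V} (hp : p ∈ D) (hpE : p ∈ E) : D = E :=
  Set.Subset.antisymm
    (h.connected.preconnected.induce_subset_of_closed
      (fun q hq r hr => hE.closed q hq r (h.subset hr)) hp hpE)
    (hE.connected.preconnected.induce_subset_of_closed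
      (fun q hq r hr => h.closed q hq r (hE.subset hr)) hpE hp)

/-- `s` separates `p` from `q` in `G.induce X`: some union of components of `X \ {s}`
contains `p` but not `q`. -/
def Separates (G : SimpleGraph V) (X : Set V) (s p q : V) : Prop :=
  ∃ C : Set V, C ⊆ X \ {s} ∧ p ∈ C ∧ q ∉ C ∧ ∀ u ∈ C, ∀ r ∈ X \ {s}, G.Adj u r → r ∈ C

/-- If `a` does not separate `b` from `c`, there is a link between `b` and `c` which is
either an edge or passes through one component of `X \ {a, b, c}`. -/
lemma exists_link_of_not_separates {X : Set V} {a b c : V} (hb : b ∈ X) (hab : a ≠ b)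
    (hbc : b ≠ c) (h : ¬ G.Separates X a b c) :
    G.Adj b c ∨ ∃ D, G.IsComponentIn (X \ {a, b, c}) D ∧ (∃ d ∈ D, G.Adj b d) ∧
      ∃ d ∈ D, G.Adj c d := by
  by_contra! hcon
  obtain ⟨hnadj, hcon⟩ := hcon
  refine h ⟨{q | q ∈ X \ {a} ∧ (q = b ∨ ∃ D, G.IsComponentIn (X \ {a, b, c}) D ∧
    (∃ d ∈ D, G.Adj b d) ∧ q ∈ D)}, fun q hq => hq.1, ⟨⟨hb, hab.symm⟩, Or.inl rfl⟩, ?_, ?_⟩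
  · rintro ⟨-, hc | ⟨D, hD, -, hc⟩⟩
    · exact hbc hc.symm
    · exact (hD.subset hc).2 (by simp)
  · rintro u ⟨-, rfl | ⟨D, hD, hbD, hu⟩⟩ r hr hur
    · refine ⟨hr, ?_⟩
      have hrX : r ∈ X \ {a, u, c} := by
        refine ⟨hr.1, ?_⟩
        rintro (rfl | rfl | rfl)
        · exact hr.2 rfl
        · exact hur.ne rfl
        · exact hnadj hur
      obtain ⟨D, hD, hrD⟩ := exists_isComponentIn (G := G) hrX
      exact Or.inr ⟨D, hD, ⟨r, hrD, hur⟩, hrD⟩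
    · refine ⟨hr, ?_⟩
      by_cases hrb : r = b
      · exact Or.inl hrb
      · refine Or.inr ⟨D, hD, hbD, hD.closed u hu r ⟨hr.1, ?_⟩ hur⟩
        rintro (rfl | rfl | rfl)
        · exact hr.2 rfl
        · exact hrb rfl
        · exact hcon D hD hbD u hu hur.symm

/-- The branch sets of a `K₃,₃` minor, given side by side. -/
lemma isMinorOf_completeBipartiteGraph {A B : Fin 3 → Set V}
    (hA : ∀ i, (G.induce (A i)).Connected) (hB : ∀ i, (G.induce (B i)).Connected)
    (hAA : ∀ i j, i ≠ j → Disjoint (A i) (A j)) (hBB : ∀ i j, i ≠ j → Disjoint (B i) (B j))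
    (hAB : ∀ i j, Disjoint (A i) (B j)) (hadj : ∀ i j, ∃ a ∈ A i, ∃ b ∈ B j, G.Adj a b) :
    (completeBipartiteGraph (Fin 3) (Fin 3)).IsMinorOf G := by
  refine ⟨Sum.elim A B, ?_, ?_, ?_, ?_⟩
  · rintro (i | i)
    · exact Set.nonempty_coe_sort.1 (hA i).nonempty
    · exact Set.nonempty_coe_sort.1 (hB i).nonempty
  · rintro (i | i)
    · exact hA i
    · exact hB i
  · rintro (i | i) (j | j) h
    · exact hAA i j (by simpa using h)
    · exact hAB i j
    · exact (hAB j i).symm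
    · exact hBB i j (by simpa using h)
  · rintro (i | i) (j | j) h
    · simp at h
    · exact hadj i j
    · obtain ⟨a, ha, b, hb, h⟩ := hadj j i
      exact ⟨b, hb, a, ha, h.symm⟩
    · simp at h

/-- A `K₃,₃` minor from three terminals all adjacent to three disjoint connected sets. -/
lemma isMinorOf_K33_of_terminals {a b c : V} (hab : a ≠ b) (hac : a ≠ c) (hbc : b ≠ c)
    {P : Fin 3 → Set V} (hP : ∀ i, (G.induce (P i)).Connected)
    (hPP : ∀ i j, i ≠ j → Disjoint (P i) (P j))
    (ha : ∀ i, a ∉ P i ∧ ∃ p ∈ P i, G.Adj p a) (hb : ∀ i, b ∉ P i ∧ ∃ p ∈ P i, G.Adj p b)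
    (hc : ∀ i, c ∉ P i ∧ ∃ p ∈ P i, G.Adj p c) :
    (completeBipartiteGraph (Fin 3) (Fin 3)).IsMinorOf G := by
  have hT : ∀ (i j : Fin 3), ![a, b, c] j ∉ P i ∧ ∃ p ∈ P i, G.Adj p (![a, b, c] j) := by
    intro i j
    fin_cases j
    · exact ha i
    · exact hb i
    · exact hc i
  refine isMinorOf_completeBipartiteGraph (A := P) (B := fun j => {![a, b, c] j}) hP
    (fun j => induce_singleton_connected _) hPP ?_ ?_ ?_
  · intro i j hij
    rw [Set.disjoint_singleton]
    fin_cases i <;> fin_cases j <;> simp_all [eq_comm]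
  · intro i j
    exact Set.disjoint_singleton_right.2 (hT i j).1
  · intro i j
    obtain ⟨p, hp, h⟩ := (hT i j).2
    exact ⟨p, hp, _, rfl, h⟩

/-- A `K₅` minor from five disjoint connected pairwise adjacent sets. -/
lemma isMinorOf_completeGraph {n : ℕ} {B : Fin n → Set V} (hB : ∀ i, (G.induce (B i)).Connected)
    (hlt : ∀ i j, i < j → Disjoint (B i) (B j) ∧ ∃ a ∈ B i, ∃ b ∈ B j, G.Adj a b) :
    (completeGraph (Fin n)).IsMinorOf G := by
  refine ⟨B, fun i => Set.nonempty_coe_sort.1 (hB i).nonempty, hB, ?_, ?_⟩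
  · intro i j hij
    rcases lt_or_gt_of_ne hij with h | h
    · exact (hlt i j h).1
    · exact (hlt j i h).1.symm
  · intro i j hij
    rcases lt_or_gt_of_ne (show i ≠ j from hij) with h | h
    · exact (hlt i j h).2
    · obtain ⟨a, ha, b, hb, h⟩ := (hlt j i h).2
      exact ⟨b, hb, a, ha, h.symm⟩

/-- A link between `b` and `c` can be absorbed into the branch set of `b`. -/
lemma exists_branch_of_link {X : Set V} {b c : V}
    (h : G.Adj b c ∨ ∃ D, G.IsComponentIn X D ∧ (∃ d ∈ D, G.Adj b d) ∧ ∃ d ∈ D, G.Adj c d) :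
    ∃ D : Set V, D ⊆ X ∧ (G.induce (insert b D)).Connected ∧ (∃ d ∈ insert b D, G.Adj d c) ∧
      (D = ∅ ∨ (G.IsComponentIn X D ∧ (∃ d ∈ D, G.Adj b d) ∧ ∃ d ∈ D, G.Adj c d)) := by
  rcases h with h | ⟨D, hD, ⟨d, hd, hbd⟩, e, he, hce⟩
  · refine ⟨∅, by simp, ?_, ⟨b, by simp, h⟩, Or.inl rfl⟩
    rw [insert_empty_eq]
    exact induce_singleton_connected b
  · exact ⟨D, hD.subset, hD.connected.preconnected.induce_insert hd hbd.symm,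
      ⟨e, Or.inr he, hce.symm⟩, Or.inr ⟨hD, ⟨d, hd, hbd⟩, e, he, hce⟩⟩

/-- In a planar graph, if a connected set `Z` and a vertex `v` adjacent to `Z` have the three
common neighbours `a`, `b`, `c` in `X`, then one of these separates the other two in `X`. -/
lemma Planar.separates {X Z : Set V} {v a b c : V} (hG : G.Planar)
    (hZ : (G.induce Z).Connected) (hZX : Disjoint Z X) (hvX : v ∉ X) (hvZ : v ∉ Z)
    (haX : a ∈ X) (hbX : b ∈ X) (hcX : c ∈ X) (hab : a ≠ b) (hac : a ≠ c) (hbc : b ≠ c)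
    (hv : ∃ z ∈ Z, G.Adj z v) (ha : ∃ z ∈ Z, G.Adj z a) (hb : ∃ z ∈ Z, G.Adj z b)
    (hc : ∃ z ∈ Z, G.Adj z c) (hva : G.Adj v a) (hvb : G.Adj v b) (hvc : G.Adj v c) :
    G.Separates X a b c ∨ G.Separates X b c a ∨ G.Separates X c a b := by
  by_contra! hcon
  obtain ⟨h1, h2, h3⟩ := hcon
  have e1 : ({b, c, a} : Set V) = {a, b, c} := by grind
  have e2 : ({c, a, b} : Set V) = {a, b, c} := by grind
  have l1 := exists_branch_of_link (exists_link_of_not_separates hbX hab hbc h1)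
  have l2 := exists_branch_of_link (exists_link_of_not_separates hcX hbc hac.symm h2)
  have l3 := exists_branch_of_link (exists_link_of_not_separates haX hac.symm hab h3)
  rw [e1] at l2
  rw [e2] at l3
  set Y := X \ {a, b, c} with hY
  have hXZ : ∀ x ∈ X, x ∉ Z := fun x hx hz => Set.disjoint_left.1 hZX hz hx
  have hno : ∀ D, G.IsComponentIn Y D → (∃ d ∈ D, G.Adj a d) → (∃ d ∈ D, G.Adj b d) →
      (∃ d ∈ D, G.Adj c d) → False := by
    rintro D hD ⟨da, hda, ha'⟩ ⟨db, hdb, hb'⟩ ⟨dc, hdc, hc'⟩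
    have hDX : D ⊆ X := hD.subset.trans Set.sdiff_subset
    refine hG.2 (isMinorOf_K33_of_terminals hab hac hbc (P := ![Z, {v}, D]) ?_ ?_ ?_ ?_ ?_)
    · intro i
      fin_cases i
      · exact hZ
      · exact induce_singleton_connected v
      · exact hD.connected
    · have d1 : Disjoint Z {v} := Set.disjoint_singleton_right.2 hvZ
      have d2 : Disjoint Z D := hZX.mono_right hDX
      have d3 : Disjoint {v} D := Set.disjoint_singleton_left.2 fun h => hvX (hDX h)
      intro i j hij
      fin_cases i <;> fin_cases j <;>
        first | exact absurd rfl hij | exact d1 | exact d2 | exact d3 | exact d1.symm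
              | exact d2.symm | exact d3.symm
    · intro i
      fin_cases i
      · exact ⟨hXZ a haX, ha⟩
      · exact ⟨hva.ne', v, rfl, hva⟩
      · exact ⟨fun h => (hD.subset h).2 (by simp), da, hda, ha'.symm⟩
    · intro i
      fin_cases i
      · exact ⟨hXZ b hbX, hb⟩
      · exact ⟨hvb.ne', v, rfl, hvb⟩
      · exact ⟨fun h => (hD.subset h).2 (by simp), db, hdb, hb'.symm⟩
    · intro i
      fin_cases i
      · exact ⟨hXZ c hcX, hc⟩
      · exact ⟨hvc.ne', v, rfl, hvc⟩
      · exact ⟨fun h => (hD.subset h).2 (by simp), dc, hdc, hc'.symm⟩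
  obtain ⟨D1, s1, c1, n1, k1⟩ := l1
  obtain ⟨D2, s2, c2, n2, k2⟩ := l2
  obtain ⟨D3, s3, c3, n3, k3⟩ := l3
  have d12 : Disjoint D1 D2 := by
    rw [Set.disjoint_left]
    intro x x1 x2
    obtain rfl | ⟨k1, kb, kc⟩ := k1
    · exact x1
    obtain rfl | ⟨k2, -, ka⟩ := k2
    · exact x2
    obtain rfl := k1.eq_of_mem k2 x1 x2
    exact hno _ k1 ka kb kc
  have d13 : Disjoint D1 D3 := by
    rw [Set.disjoint_left]
    intro x x1 x3
    obtain rfl | ⟨k1, kb, kc⟩ := k1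
    · exact x1
    obtain rfl | ⟨k3, ka, -⟩ := k3
    · exact x3
    obtain rfl := k1.eq_of_mem k3 x1 x3
    exact hno _ k1 ka kb kc
  have d23 : Disjoint D2 D3 := by
    rw [Set.disjoint_left]
    intro x x2 x3
    obtain rfl | ⟨k2, kc, -⟩ := k2
    · exact x2
    obtain rfl | ⟨k3, ka, kb⟩ := k3
    · exact x3
    obtain rfl := k2.eq_of_mem k3 x2 x3
    exact hno _ k2 ka kb kc
  have hDX : ∀ {D : Set V} {x : V}, D ⊆ Y → x ∈ X → insert x D ⊆ X := fun hD hx =>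
    Set.insert_subset hx (hD.trans Set.sdiff_subset)
  have hdis : ∀ {D D' : Set V} {x y : V}, Disjoint D D' → D ⊆ Y → D' ⊆ Y → x ≠ y →
      x ∈ ({a, b, c} : Set V) → y ∈ ({a, b, c} : Set V) →
      Disjoint (insert x D) (insert y D') := by
    intro D D' x y h hD hD' hxy hx hy
    rw [Set.disjoint_insert_left, Set.disjoint_insert_right]
    exact ⟨fun hm => hm.elim hxy fun hm => (hD' hm).2 hx, fun hm => (hD hm).2 hy, h⟩
  have hZd : ∀ {D : Set V} {x : V}, D ⊆ Y → x ∈ X → Disjoint Z (insert x D) :=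
    fun hD hx => hZX.mono_right (hDX hD hx)
  have hvd : ∀ {D : Set V} {x : V}, D ⊆ Y → x ∈ X → Disjoint {v} (insert x D) :=
    fun hD hx => Set.disjoint_singleton_left.2 fun h => hvX (hDX hD hx h)
  have hZa : ∀ {D : Set V} {x : V}, (∃ z ∈ Z, G.Adj z x) →
      ∃ p ∈ Z, ∃ q ∈ insert x D, G.Adj p q :=
    fun ⟨z, hz, h⟩ => ⟨z, hz, _, Or.inl rfl, h⟩
  have hva' : ∀ {D : Set V} {x : V}, G.Adj v x →
      ∃ p ∈ ({v} : Set V), ∃ q ∈ insert x D, G.Adj p q :=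
    fun h => ⟨v, rfl, _, Or.inl rfl, h⟩
  refine hG.1 (isMinorOf_completeGraph (B := ![Z, {v}, insert a D3, insert b D1, insert c D2])
    ?_ ?_)
  · intro i
    fin_cases i
    · exact hZ
    · exact induce_singleton_connected v
    · exact c3
    · exact c1
    · exact c2
  · have hma : a ∈ ({a, b, c} : Set V) := by simp
    have hmb : b ∈ ({a, b, c} : Set V) := by simp
    have hmc : c ∈ ({a, b, c} : Set V) := by simp
    intro i j hij
    fin_cases i <;> fin_cases j <;> first | exact absurd hij (by decide) | skip
    · exact ⟨Set.disjoint_singleton_right.2 hvZ, by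
        obtain ⟨z, hz, h⟩ := hv
        exact ⟨z, hz, v, rfl, h⟩⟩
    · exact ⟨hZd s3 haX, hZa ha⟩
    · exact ⟨hZd s1 hbX, hZa hb⟩
    · exact ⟨hZd s2 hcX, hZa hc⟩
    · exact ⟨hvd s3 haX, hva' hva⟩
    · exact ⟨hvd s1 hbX, hva' hvb⟩
    · exact ⟨hvd s2 hcX, hva' hvc⟩
    · refine ⟨hdis d13.symm s3 s1 hab hma hmb, ?_⟩
      obtain ⟨d, hd, h⟩ := n3
      exact ⟨d, hd, b, Or.inl rfl, h⟩
    · refine ⟨hdis d23.symm s3 s2 hac hma hmc, ?_⟩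
      obtain ⟨d, hd, h⟩ := n2
      exact ⟨a, Or.inl rfl, d, hd, h.symm⟩
    · refine ⟨hdis d12 s1 s2 hbc hmb hmc, ?_⟩
      obtain ⟨d, hd, h⟩ := n1
      exact ⟨d, hd, c, Or.inl rfl, h⟩

/-- The vertex `v` has a neighbour in `Z`. In the induction `Z` plays the role of the outer
face of the graph induced on `W`, and the vertices touched by `Z` that of its boundary. -/
def Touches (G : SimpleGraph V) (Z : Set V) (v : V) : Prop :=
  ∃ z ∈ Z, G.Adj z v

lemma Preconnected.induce_insert_of_touches {Z : Set V}
    (hZ : (G.induce Z).Preconnected) {v : V} (hv : G.Touches Z v) : (G.induce (insert v Z)).Preconnected := by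
  obtain ⟨z, hz, h⟩ := hv
  exact (hZ.induce_insert hz h).preconnected

/-- A finite matching, given as a set of disjoint edges, enumerated by its edges' end pairs. -/
lemma exists_fin_enum_of_matching {M : Finset (Sym2 V)} (hM : ∀ e ∈ M, e ∈ G.edgeSet)
    (hdisj : ∀ e ∈ M, ∀ f ∈ M, ∀ v ∈ e, v ∈ f → e = f) :
    ∃ (n : ℕ) (r g : Fin n → V), (∀ i, G.Adj (r i) (g i)) ∧
      Function.Injective (Sum.elim r g) ∧ {e | ∃ i, e = s(r i, g i)} = (M : Set (Sym2 V)) := by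
  let φ : Fin M.card ≃ M := M.equivFin.symm
  have hout : ∀ i, s((φ i).1.out.1, (φ i).1.out.2) = (φ i).1 := fun i => Quot.out_eq _
  have hadj : ∀ i, G.Adj (φ i).1.out.1 (φ i).1.out.2 := fun i => by
    have := hM _ (φ i).2
    rwa [← hout i] at this
  have h1 : ∀ i, (φ i).1.out.1 ∈ (φ i).1 := fun i => Sym2.out_fst_mem _
  have h2 : ∀ i, (φ i).1.out.2 ∈ (φ i).1 := fun i => Sym2.out_snd_mem _
  have hinj : ∀ i j v, v ∈ (φ i).1 → v ∈ (φ j).1 → i = j := fun i j v hi hj =>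
    φ.injective (Subtype.ext (hdisj _ (φ i).2 _ (φ j).2 v hi hj))
  refine ⟨M.card, fun i => (φ i).1.out.1, fun i => (φ i).1.out.2, hadj, ?_, ?_⟩
  · rintro (i | i) (j | j) hij <;> simp only [Sum.elim_inl, Sum.elim_inr] at hij
    · rw [hinj i j _ (h1 i) (hij ▸ h1 j)]
    · obtain rfl := hinj i j _ (h1 i) (hij ▸ h2 j)
      exact absurd hij (hadj i).ne
    · obtain rfl := hinj i j _ (h2 i) (hij ▸ h1 j)
      exact absurd hij (hadj i).ne'
    · rw [hinj i j _ (h2 i) (hij ▸ h2 j)]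
  · ext e
    simp only [hout, Set.mem_ofPred_eq, Finset.mem_coe]
    constructor
    · rintro ⟨i, rfl⟩
      exact (φ i).2
    · intro he
      exact ⟨φ.symm ⟨e, he⟩, by simp⟩

end Separation

section Polynomial

open MvPolynomial Finsupp

variable {V : Type} {K : Type} [Field K]

/-- The factor `X u + X v` of the (unsigned) graph polynomial attached to the edge `s(u, v)`. -/
noncomputable def edgeFactor (K : Type) [Field K] : Sym2 V → MvPolynomial V K :=
  Sym2.lift ⟨fun u v => X u + X v, fun _ _ => add_comm _ _⟩

@[simp]
lemma edgeFactor_mk (u v : V) : edgeFactor K s(u, v) = X u + X v := rfl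

/-- The unsigned graph polynomial of a finite set of edges. -/
noncomputable def edgePoly (K : Type) [Field K] (E : Finset (Sym2 V)) : MvPolynomial V K :=
  ∏ e ∈ E, edgeFactor K e

lemma edgePoly_isHomogeneous (E : Finset (Sym2 V)) : (edgePoly K E).IsHomogeneous E.card := by
  rw [Finset.card_eq_sum_ones]
  refine IsHomogeneous.prod _ _ _ fun e _ => ?_
  induction e with
  | _ u v => exact (isHomogeneous_X K u).add (isHomogeneous_X K v)

lemma edgePoly_union [DecidableEq V] {E F : Finset (Sym2 V)} (h : Disjoint E F) :
    edgePoly K (E ∪ F) = edgePoly K E * edgePoly K F :=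
  Finset.prod_union h

/-- The edges from `v` to the vertices of `U`. -/
def star [DecidableEq V] (v : V) (U : Finset V) : Finset (Sym2 V) :=
  U.image fun u => s(v, u)

lemma mem_star [DecidableEq V] {v : V} {U : Finset V} {e : Sym2 V} :
    e ∈ star v U ↔ ∃ u ∈ U, s(v, u) = e := by
  simp [star]

lemma mk_mem_star [DecidableEq V] {v a b : V} {U : Finset V} :
    s(a, b) ∈ star v U ↔ (a = v ∧ b ∈ U) ∨ (b = v ∧ a ∈ U) := by
  rw [mem_star]
  constructor
  · rintro ⟨u, hu, h⟩
    rcases Sym2.eq_iff.1 h with ⟨rfl, rfl⟩ | ⟨rfl, rfl⟩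
    · exact Or.inl ⟨rfl, hu⟩
    · exact Or.inr ⟨rfl, hu⟩
  · rintro (⟨rfl, hu⟩ | ⟨rfl, hu⟩)
    · exact ⟨b, hu, rfl⟩
    · exact ⟨a, hu, Sym2.eq_swap⟩

lemma edgePoly_star [DecidableEq V] (v : V) (U : Finset V) :
    edgePoly K (star v U) = ∏ u ∈ U, (X v + X u) := by
  unfold edgePoly star
  rw [Finset.prod_image]
  · rfl
  · intro a _ b _ h
    exact Sym2.congr_right.1 h

lemma sum_single_one_apply [DecidableEq V] (U : Finset V) (v : V) :
    (∑ u ∈ U, single u 1 : V →₀ ℕ) v = if v ∈ U then 1 else 0 := by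
  rw [Finsupp.finsetSum_apply]
  simp [Finsupp.single_apply]

lemma coeff_mul_X_of_apply_eq_zero {m : V →₀ ℕ} {v : V} (h : m v = 0) (p : MvPolynomial V K) :
    coeff m (p * X v) = 0 := by
  classical
  rw [coeff_mul_X', if_neg (by simpa using h)]

lemma coeff_mul_X_add_X {m : V →₀ ℕ} {v x : V} (hm : m x = 0) (hvx : v ≠ x)
    (p : MvPolynomial V K) :
    coeff (m + single v 1) (p * (X v + X x)) = coeff m p := by
  rw [mul_add, coeff_add, coeff_mul_X, coeff_mul_X_of_apply_eq_zero, add_zero]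
  simp [hm, hvx]

/-- Orienting the edges between `U` and `v` towards `v` is the only possibility when `v` has
exponent zero. -/
lemma coeff_mul_star {m : V →₀ ℕ} {v : V} {U : Finset V} (hm : m v = 0) (hv : v ∉ U)
    (p : MvPolynomial V K) :
    coeff (m + ∑ u ∈ U, single u 1) (p * ∏ u ∈ U, (X v + X u)) = coeff m p := by
  classical
  induction U using Finset.induction_on with
  | empty => simp
  | insert u U hu ih =>
    have hvU : v ∉ U := fun h => hv (Finset.mem_insert_of_mem h)
    have hvu : u ≠ v := by
      rintro rfl
      exact hv (Finset.mem_insert_self _ _)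
    rw [Finset.sum_insert hu, Finset.prod_insert hu, mul_comm (X v + X u), ← mul_assoc, mul_add,
      coeff_add, coeff_mul_X_of_apply_eq_zero, zero_add, add_comm (single u 1), ← add_assoc,
      coeff_mul_X, ih hvU]
    have h0 : ∀ w ∈ U, (single w 1 : V →₀ ℕ) v = 0 := fun w hw =>
      Finsupp.single_eq_of_ne (by rintro rfl; exact hvU hw)
    simp [hm, Finsupp.single_eq_of_ne hvu.symm, Finset.sum_eq_zero h0]

/-- If the exponent of `v` is one, then some edge between `v` and `U` is oriented away
from `v`. -/
lemma exists_coeff_ne_zero_of_star {m : V →₀ ℕ} {v : V} {U : Finset V} (hm : m v = 0)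
    (hv : v ∉ U) {p : MvPolynomial V K} (hp : ∀ α : V →₀ ℕ, α v ≠ 0 → coeff α p = 0)
    (h : coeff (m + ∑ u ∈ U, single u 1 + single v 1) (p * ∏ u ∈ U, (X v + X u)) ≠ 0) :
    ∃ u ∈ U, coeff (m + single u 1) p ≠ 0 := by
  classical
  induction U using Finset.induction_on with
  | empty =>
    refine absurd (hp _ ?_) (by simpa using h)
    simp
  | insert u U hu ih =>
    have hvU : v ∉ U := fun h => hv (Finset.mem_insert_of_mem h)
    have hvu : u ≠ v := by
      rintro rfl
      exact hv (Finset.mem_insert_self _ _)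
    rw [Finset.sum_insert hu, Finset.prod_insert hu, mul_comm (X v + X u), ← mul_assoc, mul_add,
      coeff_add, coeff_mul_X, ← add_assoc, coeff_mul_star (by simp [hm, hvu]) hvU,
      show m + single u 1 + ∑ x ∈ U, single x 1 + single v 1 =
        m + ∑ x ∈ U, single x 1 + single v 1 + single u 1 by abel, coeff_mul_X] at h
    by_cases h1 : coeff (m + single u 1) p = 0
    · rw [h1, zero_add] at h
      obtain ⟨w, hw, h⟩ := ih hvU h
      exact ⟨w, Finset.mem_insert_of_mem hw, h⟩
    · exact ⟨u, Finset.mem_insert_self _ _, h1⟩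

lemma coeff_edgePoly_eq_zero {E : Finset (Sym2 V)} {v : V} (hE : ∀ e ∈ E, v ∉ e) {α : V →₀ ℕ}
    (hα : α v ≠ 0) : coeff α (edgePoly K E) = 0 := by
  classical
  by_contra h
  have hvars : v ∈ (edgePoly K E).vars :=
    (mem_vars_iff_mem_support v).2 ⟨α, MvPolynomial.mem_support_iff.2 h, Finsupp.mem_support_iff.2 hα⟩
  obtain ⟨e, he, hve⟩ := Finset.mem_biUnion.1 (vars_prod _ hvars)
  refine hE e he ?_
  induction e with
  | _ a b =>
    have := vars_add_subset _ _ hve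
    simpa [vars_X] using this

lemma coeff_edgePoly_mul {E F : Finset (Sym2 V)} {m n : V →₀ ℕ}
    (hE : ∀ e ∈ E, ∀ v ∈ e, n v = 0) (hmn : ∀ v, n v ≠ 0 → m v = 0)
    (hn : coeff n (edgePoly K F) ≠ 0) :
    coeff (m + n) (edgePoly K E * edgePoly K F) =
      coeff m (edgePoly K E) * coeff n (edgePoly K F) := by
  classical
  rw [coeff_mul]
  refine Finset.sum_eq_single_of_mem (m, n) (by simp) ?_
  rintro ⟨α, β⟩ hαβ hne
  rw [Finset.HasAntidiagonal.mem_antidiagonal] at hαβ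
  by_contra hcon
  obtain ⟨hα, hβ⟩ := mul_ne_zero_iff.1 hcon
  have hle : n ≤ β := by
    intro v
    by_cases hv : n v = 0
    · simp [hv]
    have hα0 : α v = 0 := by
      by_contra h
      exact hα (coeff_edgePoly_eq_zero (fun e he hve => hv (hE e he v hve)) h)
    have := DFunLike.congr_fun hαβ v
    simp only [Finsupp.add_apply, hα0, hmn v hv] at this
    omega
  have hdeg : β.degree = n.degree := by
    have hF := edgePoly_isHomogeneous (K := K) F
    by_contra h
    have h1 : n.degree = F.card := by
      by_contra h
      exact hn (hF.coeff_eq_zero h)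
    exact hβ (hF.coeff_eq_zero (by rwa [← h1]))
  obtain ⟨γ, rfl⟩ := exists_add_of_le hle
  have hγ : γ = 0 := by
    rw [map_add] at hdeg
    exact (Finsupp.degree_eq_zero_iff γ).1 (by omega)
  subst hγ
  rw [add_zero] at hαβ hne
  exact hne (Prod.ext (add_right_cancel hαβ) rfl)

/-- The combinatorial Nullstellensatz for the unsigned graph polynomial in characteristic two:
a nonvanishing coefficient whose exponents are below the list sizes yields a list colouring. -/
lemma exists_coloring_of_coeff_ne_zero [Finite V] {E : Finset (Sym2 V)} [CharP K 2] [Infinite K]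
    {m : V →₀ ℕ} (hm : coeff m (edgePoly K E) ≠ 0) (L : V → Finset ℕ)
    (hL : ∀ v, m v < (L v).card) :
    ∃ c : V → ℕ, (∀ v, c v ∈ L v) ∧ ∀ u w : V, s(u, w) ∈ E → c u ≠ c w := by
  classical
  let f : ℕ ↪ K := Infinite.natEmbedding K
  have hhom := edgePoly_isHomogeneous (K := K) E
  have hdeg : (edgePoly K E).totalDegree = m.degree := by
    rw [hhom.totalDegree (by rintro h; simp [h] at hm)]
    by_contra h
    exact hm (hhom.coeff_eq_zero (Ne.symm h))
  obtain ⟨s, hs, hev⟩ := combinatorial_nullstellensatz_exists_eval_nonzero (edgePoly K E) m hm hdeg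
    (fun v => (L v).map f) (fun v => by simpa using hL v)
  simp only [Finset.mem_map] at hs
  choose c hc hcs using hs
  refine ⟨c, hc, fun u w huw heq => hev ?_⟩
  unfold edgePoly
  rw [map_prod]
  refine Finset.prod_eq_zero huw ?_
  rw [edgeFactor_mk, map_add, eval_X, eval_X, ← hcs u, ← hcs w, heq]
  exact CharTwo.add_self_eq_zero _

end Polynomial

section GoodMatching

open MvPolynomial Finsupp

variable {V : Type} [Fintype V] [DecidableEq V] {G : SimpleGraph V} {K : Type} [Field K]
  {Z Z' : Set V} {W T : Finset V} {M : Finset (Sym2 V)} {m : V →₀ ℕ}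

open Classical in
/-- The edges of `G` with both ends in `W`. -/
noncomputable def edgesIn (G : SimpleGraph V) (W : Finset V) : Finset (Sym2 V) :=
  Finset.univ.filter fun e => e ∈ G.edgeSet ∧ ∀ v ∈ e, v ∈ W

lemma mk_mem_edgesIn {a b : V} : s(a, b) ∈ G.edgesIn W ↔ G.Adj a b ∧ a ∈ W ∧ b ∈ W := by
  simp [edgesIn]

/-- `M` is a matching of `G.induce W` avoiding `T`, and `m` is the exponent of a nonvanishing
monomial of the graph polynomial of `G.induce W` without `M` and without the edges in `T`,
subject to the bounds: `0` on `T`, `2` on vertices touched by `Z` (or `1`, if covered by `M`),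
and `3` elsewhere. -/
structure IsGood (K : Type) [Field K] (G : SimpleGraph V) (Z : Set V) (W T : Finset V)
    (M : Finset (Sym2 V)) (m : V →₀ ℕ) : Prop where
  subset : M ⊆ G.edgesIn W
  eq_of_mem : ∀ e ∈ M, ∀ f ∈ M, ∀ v ∈ e, v ∈ f → e = f
  notMem : ∀ e ∈ M, ∀ v ∈ e, v ∉ T
  support : ∀ v ∉ W, m v = 0
  eq_zero : ∀ v ∈ T, m v = 0
  le_two : ∀ v ∈ W, G.Touches Z v → m v ≤ 2
  le_one : ∀ v ∈ W, G.Touches Z v → ∀ e ∈ M, v ∈ e → m v ≤ 1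
  le_three : ∀ v, m v ≤ 3
  coeff_ne : coeff m (edgePoly K ((G.edgesIn W \ G.edgesIn T) \ M)) ≠ 0

lemma IsGood.mem_of_mem_edge (h : IsGood K G Z W T M m) {e : Sym2 V}
    (he : e ∈ M) {v : V} (hv : v ∈ e) : v ∈ W := by
  have := h.subset he
  simp only [edgesIn, Finset.mem_filter] at this
  exact this.2.2 v hv

/-- Reinsert a vertex `x` none of whose neighbours outside `T` is touched by `Z`. -/
lemma IsGood.absorb {x : V} (hx : x ∈ W) (hxT : x ∈ T ∨ T = ∅)
    (hnb : ∀ u ∈ W, G.Adj x u → u ∉ T → ¬ G.Touches Z u)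
    (hZZ' : ∀ u ∈ W, u ≠ x → G.Touches Z u → G.Touches Z' u)
    (hxZ' : ∀ u, G.Adj x u → G.Touches Z' u)
    (h : IsGood K G Z' (W.erase x) (T.erase x) M m) :
    ∃ m', IsGood K G Z W T M m' := by
  classical
  set U : Finset V := W.filter fun u => G.Adj x u ∧ u ∉ T with hU
  have hxU : x ∉ U := by simp [hU]
  have hmx : m x = 0 := h.support x (by simp)
  have hxM : ∀ e ∈ M, x ∉ e := fun e he hxe => by simpa using h.mem_of_mem_edge he hxe
  have happ : ∀ v, (m + ∑ u ∈ U, single u 1 : V →₀ ℕ) v = m v + if v ∈ U then 1 else 0 := fun v => by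
    rw [Finsupp.add_apply, sum_single_one_apply]
  refine ⟨m + ∑ u ∈ U, single u 1, ?_, h.eq_of_mem, ?_, ?_, ?_, ?_, ?_, ?_, ?_⟩
  · intro e he
    induction e with
    | _ a b =>
      have := mk_mem_edgesIn.1 (h.subset he)
      exact mk_mem_edgesIn.2 ⟨this.1, Finset.mem_of_mem_erase this.2.1,
        Finset.mem_of_mem_erase this.2.2⟩
  · intro e he v hv hvT
    exact h.notMem e he v hv (Finset.mem_erase.2 ⟨by rintro rfl; exact hxM e he hv, hvT⟩)
  · intro v hv
    rw [happ, h.support v (by simp [hv]), if_neg (by simp [hU, hv])]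
  · intro v hv
    rw [happ, if_neg (by simp [hU, hv])]
    by_cases hvx : v = x
    · rw [hvx, hmx]
    · rw [h.eq_zero v (by simp [hvx, hv])]
  · intro v hv hvZ
    have hvU : v ∉ U := fun hvU => by
      simp only [hU, Finset.mem_filter] at hvU
      exact hnb v hv hvU.2.1 hvU.2.2 hvZ
    rw [happ, if_neg hvU]
    by_cases hvx : v = x
    · rw [hvx, hmx]; omega
    · exact h.le_two v (by simp [hvx, hv]) (hZZ' v hv hvx hvZ)
  · intro v hv hvZ e he hve
    have hvU : v ∉ U := fun hvU => by
      simp only [hU, Finset.mem_filter] at hvU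
      exact hnb v hv hvU.2.1 hvU.2.2 hvZ
    have hvx : v ≠ x := by rintro rfl; exact hxM e he hve
    rw [happ, if_neg hvU]
    exact h.le_one v (by simp [hvx, hv]) (hZZ' v hv hvx hvZ) e he hve
  · intro v
    rw [happ]
    split_ifs with hvU
    · have hvx : v ≠ x := by rintro rfl; exact hxU hvU
      simp only [hU, Finset.mem_filter] at hvU
      have := h.le_two v (by simp [hvx, hvU.1]) (hxZ' v hvU.2.1)
      omega
    · exact h.le_three v
  · have hE : (G.edgesIn W \ G.edgesIn T) \ M =
        ((G.edgesIn (W.erase x) \ G.edgesIn (T.erase x)) \ M) ∪ star x U := by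
      ext e
      have hxe := hxM e
      induction e with
      | _ a b =>
        simp only [Sym2.mem_iff] at hxe
        simp only [Finset.mem_union, Finset.mem_sdiff, mk_mem_edgesIn, mk_mem_star, hU,
          Finset.mem_erase, Finset.mem_filter]
        have := @SimpleGraph.Adj.symm V G
        grind
    have hdisj : Disjoint ((G.edgesIn (W.erase x) \ G.edgesIn (T.erase x)) \ M) (star x U) := by
      rw [Finset.disjoint_left]
      intro e
      induction e with
      | _ a b =>
        simp only [Finset.mem_sdiff, mk_mem_edgesIn, mk_mem_star, Finset.mem_erase]
        grind
    rw [hE, edgePoly_union hdisj, edgePoly_star, coeff_mul_star hmx hxU]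
    exact h.coeff_ne

/-- Extend a good pair from `W.erase v` to `W` without changing the matching. -/
lemma IsGood.extend {v : V} {n : V →₀ ℕ} {N U : Finset V}
    (hv : v ∈ W) (hvT : v ∉ T) (hTZ : ∀ t ∈ T, G.Touches Z t)
    (hN : ∀ u, u ∈ N ↔ u ∈ W ∧ G.Adj v u) (hU : ∀ u ∈ U, u ∈ N ∧ ¬ G.Touches Z u)
    (h : IsGood K G (insert v Z) (W.erase v) T M m)
    (hnv : n v ≤ 2) (hnU : ∀ u ∈ U, n u ≤ 3) (hn : ∀ u, u ≠ v → u ∉ U → n u ≤ m u)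
    (hcoeff : coeff n (edgePoly K ((G.edgesIn (W.erase v) \ G.edgesIn T) \ M) *
      ∏ u ∈ N, (X v + X u)) ≠ 0) :
    IsGood K G Z W T M n := by
  have hvM : ∀ e ∈ M, v ∉ e := fun e he hve => by simpa using h.mem_of_mem_edge he hve
  have hZZ' : ∀ u, G.Touches Z u → G.Touches (insert v Z) u :=
    fun u ⟨z, hz, hzu⟩ => ⟨z, Or.inr hz, hzu⟩
  refine ⟨?_, h.eq_of_mem, h.notMem, ?_, ?_, ?_, ?_, ?_, ?_⟩
  · intro e he
    induction e with
    | _ a b =>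
      have := mk_mem_edgesIn.1 (h.subset he)
      exact mk_mem_edgesIn.2 ⟨this.1, Finset.mem_of_mem_erase this.2.1,
        Finset.mem_of_mem_erase this.2.2⟩
  · intro u hu
    have := hn u (by rintro rfl; exact hu hv) (fun h' => hu ((hN u).1 (hU u h').1).1)
    have := h.support u (by simp [hu])
    omega
  · intro u hu
    have := hn u (by rintro rfl; exact hvT hu) (fun h' => (hU u h').2 (hTZ u hu))
    have := h.eq_zero u hu
    omega
  · intro u hu huZ
    by_cases huv : u = v
    · rwa [huv]
    · exact (hn u huv fun h' => (hU u h').2 huZ).trans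
        (h.le_two u (by simp [huv, hu]) (hZZ' u huZ))
  · intro u hu huZ e he hue
    have huv : u ≠ v := by rintro rfl; exact hvM e he hue
    exact (hn u huv fun h' => (hU u h').2 huZ).trans
      (h.le_one u (by simp [huv, hu]) (hZZ' u huZ) e he hue)
  · intro u
    by_cases huv : u = v
    · rw [huv]; omega
    by_cases huU : u ∈ U
    · exact hnU u huU
    · exact (hn u huv huU).trans (h.le_three u)
  · have hE : (G.edgesIn W \ G.edgesIn T) \ M =
        ((G.edgesIn (W.erase v) \ G.edgesIn T) \ M) ∪ star v N := by
      ext e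
      have hve := hvM e
      induction e with
      | _ a b =>
        simp only [Sym2.mem_iff] at hve
        simp only [Finset.mem_union, Finset.mem_sdiff, mk_mem_edgesIn, mk_mem_star, hN,
          Finset.mem_erase]
        have := @SimpleGraph.Adj.symm V G
        grind
    have hdisj : Disjoint ((G.edgesIn (W.erase v) \ G.edgesIn T) \ M) (star v N) := by
      rw [Finset.disjoint_left]
      intro e
      induction e with
      | _ a b =>
        simp only [Finset.mem_sdiff, mk_mem_edgesIn, mk_mem_star, Finset.mem_erase]
        grind
    rwa [hE, edgePoly_union hdisj, edgePoly_star]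

/-- Extend a good pair from `W.erase v` to `W` by adding the edge `s(v, u₀)` to the matching. -/
lemma IsGood.extend_insert {v u₀ : V} {n : V →₀ ℕ} {N U : Finset V}
    (hv : v ∈ W) (hvT : v ∉ T) (hTZ : ∀ t ∈ T, G.Touches Z t)
    (hN : ∀ u, u ∈ N ↔ u ∈ W ∧ G.Adj v u) (hU : ∀ u ∈ U, u ∈ N ∧ ¬ G.Touches Z u)
    (h : IsGood K G (insert v Z) (W.erase v) T M m) (hu₀ : u₀ ∈ U) (hu₀M : ∀ e ∈ M, u₀ ∉ e)
    (hnv : n v ≤ 1) (hnU : ∀ u ∈ U, n u ≤ 3) (hn : ∀ u, u ≠ v → u ∉ U → n u ≤ m u)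
    (hcoeff : coeff n (edgePoly K ((G.edgesIn (W.erase v) \ G.edgesIn T) \ M) *
      ∏ u ∈ N.erase u₀, (X v + X u)) ≠ 0) :
    IsGood K G Z W T (insert s(v, u₀) M) n := by
  have hvM : ∀ e ∈ M, v ∉ e := fun e he hve => by simpa using h.mem_of_mem_edge he hve
  have hZZ' : ∀ u, G.Touches Z u → G.Touches (insert v Z) u :=
    fun u ⟨z, hz, hzu⟩ => ⟨z, Or.inr hz, hzu⟩
  obtain ⟨hu₀N, hu₀Z⟩ := hU u₀ hu₀
  obtain ⟨hu₀W, hvu₀⟩ := (hN u₀).1 hu₀N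
  refine ⟨?_, ?_, ?_, ?_, ?_, ?_, ?_, ?_, ?_⟩
  · intro e he
    rcases Finset.mem_insert.1 he with rfl | he
    · exact mk_mem_edgesIn.2 ⟨hvu₀, hv, hu₀W⟩
    induction e with
    | _ a b =>
      have := mk_mem_edgesIn.1 (h.subset he)
      exact mk_mem_edgesIn.2 ⟨this.1, Finset.mem_of_mem_erase this.2.1,
        Finset.mem_of_mem_erase this.2.2⟩
  · have hnew : ∀ f ∈ M, ∀ u ∈ s(v, u₀), u ∉ f := by
      intro f hf u hu
      rcases Sym2.mem_iff.1 hu with rfl | rfl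
      · exact hvM f hf
      · exact hu₀M f hf
    intro e he f hf u hue huf
    rcases Finset.mem_insert.1 he with rfl | he <;> rcases Finset.mem_insert.1 hf with rfl | hf
    · rfl
    · exact absurd huf (hnew f hf u hue)
    · exact absurd hue (hnew e he u huf)
    · exact h.eq_of_mem e he f hf u hue huf
  · intro e he u hu
    rcases Finset.mem_insert.1 he with rfl | he
    · rcases Sym2.mem_iff.1 hu with rfl | rfl
      · exact hvT
      · exact fun hT => hu₀Z (hTZ u hT)
    · exact h.notMem e he u hu
  · intro u hu
    have := hn u (by rintro rfl; exact hu hv) (fun h' => hu ((hN u).1 (hU u h').1).1)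
    have := h.support u (by simp [hu])
    omega
  · intro u hu
    have := hn u (by rintro rfl; exact hvT hu) (fun h' => (hU u h').2 (hTZ u hu))
    have := h.eq_zero u hu
    omega
  · intro u hu huZ
    by_cases huv : u = v
    · rw [huv]; omega
    · exact (hn u huv fun h' => (hU u h').2 huZ).trans
        (h.le_two u (by simp [huv, hu]) (hZZ' u huZ))
  · intro u hu huZ e he hue
    by_cases huv : u = v
    · rwa [huv]
    rcases Finset.mem_insert.1 he with rfl | he
    · rcases Sym2.mem_iff.1 hue with rfl | rfl
      · exact absurd rfl huv
      · exact absurd huZ hu₀Z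
    · exact (hn u huv fun h' => (hU u h').2 huZ).trans
        (h.le_one u (by simp [huv, hu]) (hZZ' u huZ) e he hue)
  · intro u
    by_cases huv : u = v
    · rw [huv]; omega
    by_cases huU : u ∈ U
    · exact hnU u huU
    · exact (hn u huv huU).trans (h.le_three u)
  · have hE : (G.edgesIn W \ G.edgesIn T) \ insert s(v, u₀) M =
        ((G.edgesIn (W.erase v) \ G.edgesIn T) \ M) ∪ star v (N.erase u₀) := by
      ext e
      have hve := hvM e
      induction e with
      | _ a b =>
        simp only [Sym2.mem_iff] at hve
        simp only [Finset.mem_union, Finset.mem_sdiff, mk_mem_edgesIn, mk_mem_star, hN,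
          Finset.mem_erase, Finset.mem_insert, Sym2.eq_iff]
        have := @SimpleGraph.Adj.symm V G
        grind
    have hdisj : Disjoint ((G.edgesIn (W.erase v) \ G.edgesIn T) \ M)
        (star v (N.erase u₀)) := by
      rw [Finset.disjoint_left]
      intro e
      induction e with
      | _ a b =>
        simp only [Finset.mem_sdiff, mk_mem_edgesIn, mk_mem_star, Finset.mem_erase]
        grind
    rwa [hE, edgePoly_union hdisj, edgePoly_star]

/-- Glue good pairs along an edge or vertex set `S` contained in both sides. -/
lemma IsGood.glue {C S : Finset V} {M₁ M₂ : Finset (Sym2 V)} {m₁ m₂ : V →₀ ℕ}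
    (hCW : C ⊆ W) (hSW : S ⊆ W \ C) (hTC : ∀ t ∈ T, t ∉ C)
    (hC : ∀ u ∈ C, ∀ r ∈ W, G.Adj u r → r ∈ C ∪ S)
    (h₁ : IsGood K G Z (W \ C) T M₁ m₁) (h₂ : IsGood K G Z (C ∪ S) S M₂ m₂) :
    IsGood K G Z W T (M₁ ∪ M₂) (m₁ + m₂) := by
  have hC1 : ∀ v ∈ C, m₁ v = 0 := fun v hv => h₁.support v (by simp [hv])
  have hC2 : ∀ v ∉ C, m₂ v = 0 := fun v hv => by
    by_cases hvS : v ∈ S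
    · exact h₂.eq_zero v hvS
    · exact h₂.support v (by simp [hv, hvS])
  have hM1 : ∀ e ∈ M₁, ∀ v ∈ e, v ∈ W ∧ v ∉ C := fun e he v hv => by
    simpa using h₁.mem_of_mem_edge he hv
  have hM2 : ∀ e ∈ M₂, ∀ v ∈ e, v ∈ C := fun e he v hv => by
    have := h₂.mem_of_mem_edge he hv
    have := h₂.notMem e he v hv
    simp_all
  refine ⟨?_, ?_, ?_, ?_, ?_, ?_, ?_, ?_, ?_⟩
  · intro e he
    rcases Finset.mem_union.1 he with he | he
    · have hs := h₁.subset he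
      have hw := hM1 e he
      simp only [edgesIn, Finset.mem_filter] at hs ⊢
      exact ⟨hs.1, hs.2.1, fun v hv => (hw v hv).1⟩
    · have hs := h₂.subset he
      have hw := hM2 e he
      simp only [edgesIn, Finset.mem_filter] at hs ⊢
      exact ⟨hs.1, hs.2.1, fun v hv => hCW (hw v hv)⟩
  · intro e he f hf v hve hvf
    rcases Finset.mem_union.1 he with he | he <;> rcases Finset.mem_union.1 hf with hf | hf
    · exact h₁.eq_of_mem e he f hf v hve hvf
    · exact absurd (hM2 f hf v hvf) (hM1 e he v hve).2
    · exact absurd (hM2 e he v hve) (hM1 f hf v hvf).2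
    · exact h₂.eq_of_mem e he f hf v hve hvf
  · intro e he v hv hvT
    rcases Finset.mem_union.1 he with he | he
    · exact h₁.notMem e he v hv hvT
    · exact hTC v hvT (hM2 e he v hv)
  · intro v hv
    rw [Finsupp.add_apply, h₁.support v (by simp [hv]), hC2 v fun h => hv (hCW h)]
  · intro v hv
    rw [Finsupp.add_apply, h₁.eq_zero v hv, hC2 v (hTC v hv)]
  · intro v hv hvZ
    rw [Finsupp.add_apply]
    by_cases hvC : v ∈ C
    · rw [hC1 v hvC, zero_add]
      exact h₂.le_two v (by simp [hvC]) hvZ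
    · rw [hC2 v hvC, add_zero]
      exact h₁.le_two v (by simp [hv, hvC]) hvZ
  · intro v hv hvZ e he hve
    rw [Finsupp.add_apply]
    rcases Finset.mem_union.1 he with he | he
    · rw [hC2 v (hM1 e he v hve).2, add_zero]
      exact h₁.le_one v (by simpa using hM1 e he v hve) hvZ e he hve
    · have hvC := hM2 e he v hve
      rw [hC1 v hvC, zero_add]
      exact h₂.le_one v (by simp [hvC]) hvZ e he hve
  · intro v
    rw [Finsupp.add_apply]
    by_cases hvC : v ∈ C
    · rw [hC1 v hvC, zero_add]
      exact h₂.le_three v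
    · rw [hC2 v hvC, add_zero]
      exact h₁.le_three v
  · have hE : (G.edgesIn W \ G.edgesIn T) \ (M₁ ∪ M₂) =
        ((G.edgesIn (W \ C) \ G.edgesIn T) \ M₁) ∪
          ((G.edgesIn (C ∪ S) \ G.edgesIn S) \ M₂) := by
      ext e
      have h1 := hM1 e
      have h2 := hM2 e
      induction e with
      | _ a b =>
        simp only [Sym2.mem_iff] at h1 h2
        simp only [Finset.mem_union, Finset.mem_sdiff, mk_mem_edgesIn]
        have hs := @SimpleGraph.Adj.symm V G
        have hSW' : ∀ s ∈ S, s ∈ W ∧ s ∉ C := fun s hs => by simpa using hSW hs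
        have hCa := hC a
        have hCb := hC b
        simp only [Finset.mem_union] at hCa hCb
        grind
    have hdisj : Disjoint ((G.edgesIn (W \ C) \ G.edgesIn T) \ M₁)
        ((G.edgesIn (C ∪ S) \ G.edgesIn S) \ M₂) := by
      rw [Finset.disjoint_left]
      intro e
      induction e with
      | _ a b =>
        simp only [Finset.mem_sdiff, mk_mem_edgesIn, Finset.mem_union]
        grind
    rw [hE, edgePoly_union hdisj, coeff_edgePoly_mul ?_ ?_ h₂.coeff_ne]
    · exact mul_ne_zero h₁.coeff_ne h₂.coeff_ne
    · intro e he v hv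
      refine hC2 v ?_
      simp only [Finset.mem_sdiff, edgesIn, Finset.mem_filter] at he
      exact (he.1.1.2.2 v hv).2
    · intro v hv
      exact hC1 v (by by_contra h; exact hv (hC2 v h))

/-- Reinsert a vertex `v` adjacent to `x ∈ T` that has at most one further neighbour touched
by `Z`. -/
lemma IsGood.exists_extend {v x : V} (hv : v ∈ W) (hvT : v ∉ T) (hTW : T ⊆ W)
    (hTZ : ∀ t ∈ T, G.Touches Z t) (hxT : x ∈ T) (hvx : G.Adj v x)
    (hw : ∀ w₁ ∈ W, ∀ w₂ ∈ W, G.Adj v w₁ → G.Adj v w₂ → G.Touches Z w₁ → G.Touches Z w₂ →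
      w₁ ≠ x → w₂ ≠ x → w₁ = w₂)
    (h : IsGood K G (insert v Z) (W.erase v) T M m) :
    ∃ M' m', IsGood K G Z W T M' m' := by
  classical
  set N : Finset V := W.filter fun u => G.Adj v u with hNdef
  set U : Finset V := N.filter fun u => ¬ G.Touches Z u with hUdef
  have hN : ∀ u, u ∈ N ↔ u ∈ W ∧ G.Adj v u := fun u => by simp [hNdef]
  have hU : ∀ u ∈ U, u ∈ N ∧ ¬ G.Touches Z u := fun u hu => by simpa [hUdef] using hu
  have hvU : v ∉ U := fun hvU => G.loopless.irrefl v ((hN v).1 (hU v hvU).1).2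
  have hxU : x ∉ U := fun hxU => (hU x hxU).2 (hTZ x hxT)
  have hmv : m v = 0 := h.support v (by simp)
  have hmx : m x = 0 := h.eq_zero x hxT
  have hmU : ∀ u ∈ U, m u ≤ 2 := fun u hu => by
    have hu' := (hN u).1 (hU u hu).1
    exact h.le_two u (by simp [hu'.1, hu'.2.ne']) ⟨v, Or.inl rfl, hu'.2⟩
  set Q := edgePoly K ((G.edgesIn (W.erase v) \ G.edgesIn T) \ M) with hQ
  by_cases hex : ∃ w ∈ N, G.Touches Z w ∧ w ≠ x
  · obtain ⟨w, hwN, hwZ, hwx⟩ := hex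
    obtain ⟨hwW, hvw⟩ := (hN w).1 hwN
    have hwU : w ∉ U := fun hwU => (hU w hwU).2 hwZ
    have hNU : N = insert x (insert w U) := by
      ext u
      simp only [Finset.mem_insert, hUdef, Finset.mem_filter]
      constructor
      · intro hu
        have hu' := (hN u).1 hu
        by_cases hux : u = x
        · exact Or.inl hux
        by_cases huZ : G.Touches Z u
        · exact Or.inr (Or.inl (hw u hu'.1 w hwW hu'.2 hvw huZ hwZ hux hwx))
        · exact Or.inr (Or.inr ⟨hu, huZ⟩)
      · rintro (rfl | rfl | hu)
        · exact (hN u).2 ⟨hTW hxT, hvx⟩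
        · exact hwN
        · exact hu.1
    have hxwU : x ∉ insert w U := by simp [hxU, hwx.symm]
    have hprod : Q * ∏ u ∈ N, (X v + X u) =
        Q * (∏ u ∈ U, (X v + X u)) * (X v + X w) * (X v + X x) := by
      rw [hNU, Finset.prod_insert hxwU, Finset.prod_insert hwU]
      ring
    have hprod' : Q * ∏ u ∈ N, (X v + X u) =
        Q * (∏ u ∈ insert w U, (X v + X u)) * (X v + X x) := by
      rw [hNU, Finset.prod_insert hxwU]
      ring
    by_cases htwo : coeff (m + ∑ u ∈ U, single u 1 + single v 1)
        (Q * (∏ u ∈ U, (X v + X u)) * (X v + X w)) = 0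
    · rw [mul_add, coeff_add, coeff_mul_X, coeff_mul_star hmv hvU] at htwo
      have hmw : m w ≠ 0 := by
        intro hmw
        rw [coeff_mul_X_of_apply_eq_zero, add_zero] at htwo
        · exact h.coeff_ne htwo
        · simp only [Finsupp.add_apply, sum_single_one_apply, hmw, if_neg hwU]
          simp [hvw.ne]
      have hle : single w 1 ≤ m := by
        rw [Finsupp.single_le_iff]
        omega
      obtain ⟨m₀, hm₀⟩ := exists_add_of_le hle
      have hm₀v : m₀ v = 0 := by
        have := DFunLike.congr_fun hm₀ v
        simp only [Finsupp.add_apply] at this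
        omega
      have hm₀x : m₀ x = 0 := by
        have := DFunLike.congr_fun hm₀ x
        simp only [Finsupp.add_apply] at this
        omega
      rw [show m + ∑ u ∈ U, single u 1 + single v 1 =
          m₀ + ∑ u ∈ U, single u 1 + single v 1 + single w 1 by rw [hm₀]; abel,
        coeff_mul_X] at htwo
      have hne : coeff (m₀ + ∑ u ∈ U, single u 1 + single v 1)
          (Q * ∏ u ∈ U, (X v + X u)) ≠ 0 := by
        intro h0
        rw [h0, add_zero] at htwo
        exact h.coeff_ne htwo
      obtain ⟨u₀, hu₀, hne⟩ := exists_coeff_ne_zero_of_star hm₀v hvU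
        (fun α hα => coeff_edgePoly_eq_zero (fun e he hve => by
          simp only [Finset.mem_sdiff, edgesIn, Finset.mem_filter] at he
          simpa using he.1.1.2.2 v hve) hα) hne
      have hu₀v : u₀ ≠ v := by rintro rfl; exact hvU hu₀
      have hu₀x : u₀ ≠ x := by rintro rfl; exact hxU hu₀
      have hu₀w : u₀ ≠ w := by rintro rfl; exact hwU hu₀
      have hm₀app : ∀ u, m u = (if u = w then 1 else 0) + m₀ u := fun u => by
        rw [hm₀, Finsupp.add_apply, Finsupp.single_apply]
        simp only [eq_comm]
      by_cases hcov : ∃ e ∈ M, u₀ ∈ e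
      · obtain ⟨e, he, hu₀e⟩ := hcov
        have hmu₀ : m u₀ ≤ 1 := by
          have hu' := (hN u₀).1 (hU u₀ hu₀).1
          exact h.le_one u₀ (by simp [hu'.1, hu₀v]) ⟨v, Or.inl rfl, hu'.2⟩ e he hu₀e
        have happ : ∀ u, (m₀ + single u₀ 1 + ∑ u ∈ insert w U, single u 1 + single v 1 :
            V →₀ ℕ) u = m₀ u + (if u = u₀ then 1 else 0) + (if u ∈ insert w U then 1 else 0) +
              (if u = v then 1 else 0) := fun u => by
          simp only [Finsupp.add_apply, sum_single_one_apply, Finsupp.single_apply, eq_comm]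
        refine ⟨M, _, h.extend (n := m₀ + single u₀ 1 + ∑ u ∈ insert w U, single u 1 + single v 1)
          hv hvT hTZ hN hU ?_ ?_ ?_ ?_⟩
        · rw [happ]
          simp [hm₀v, hu₀v.symm, hvU, hvw.ne]
        · intro u hu
          have h1 := hmU u hu
          have h2 := hm₀app u
          have huv : u ≠ v := by rintro rfl; exact hvU hu
          rw [happ, if_neg huv]
          split_ifs at * with h3 <;> subst_vars <;> omega
        · intro u huv huU
          have huu₀ : u ≠ u₀ := by rintro rfl; exact huU hu₀
          rw [happ, hm₀app u]
          simp only [huv, huu₀, Finset.mem_insert, huU, or_false, if_false]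
          omega
        · rw [hprod', coeff_mul_X_add_X _ hvx.ne, coeff_mul_star]
          · exact hne
          · simp [hm₀v, hu₀v]
          · simp [hvU, hvw.ne]
          · simp only [Finsupp.add_apply, sum_single_one_apply, hm₀x, if_neg hxwU]
            simp [hu₀x]
      · push Not at hcov
        have hwU' : w ∉ U.erase u₀ := fun h' => hwU (Finset.mem_of_mem_erase h')
        have hxwU' : x ∉ insert w (U.erase u₀) := by simp [hxU, hwx.symm]
        have happ : ∀ u, (m₀ + single u₀ 1 + ∑ u ∈ insert w (U.erase u₀), single u 1 +
            single v 1 : V →₀ ℕ) u = m₀ u + (if u = u₀ then 1 else 0) +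
              (if u ∈ insert w (U.erase u₀) then 1 else 0) +
              (if u = v then 1 else 0) := fun u => by
          simp only [Finsupp.add_apply, sum_single_one_apply, Finsupp.single_apply, eq_comm]
        have herase : N.erase u₀ = insert x (insert w (U.erase u₀)) := by
          rw [hNU, Finset.erase_insert_of_ne hu₀x.symm, Finset.erase_insert_of_ne hu₀w.symm]
        refine ⟨_, _, h.extend_insert
          (n := m₀ + single u₀ 1 + ∑ u ∈ insert w (U.erase u₀), single u 1 + single v 1)
          hv hvT hTZ hN hU hu₀ hcov ?_ ?_ ?_ ?_⟩
        · rw [happ]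
          simp [hm₀v, hu₀v.symm, hvU, hvw.ne]
        · intro u hu
          have h1 := hmU u hu
          have h2 := hm₀app u
          have huv : u ≠ v := by rintro rfl; exact hvU hu
          have huw : u ≠ w := by rintro rfl; exact hwU hu
          rw [happ, if_neg huv]
          by_cases huu₀ : u = u₀
          · subst huu₀
            simp [huw]
            omega
          · simp [huu₀, huw, hu]
            omega
        · intro u huv huU
          have huu₀ : u ≠ u₀ := by rintro rfl; exact huU hu₀
          rw [happ, hm₀app u]
          simp only [huv, huu₀, Finset.mem_insert, Finset.mem_erase, huU, or_false, and_false,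
            if_false]
          omega
        · rw [herase, Finset.prod_insert hxwU', mul_comm (X v + X x), ← mul_assoc,
            coeff_mul_X_add_X _ hvx.ne, coeff_mul_star]
          · exact hne
          · simp [hm₀v, hu₀v]
          · simp [hvU, hvw.ne]
          · simp only [Finsupp.add_apply, sum_single_one_apply, hm₀x, if_neg hxwU']
            simp [hu₀x]
    · have happ : ∀ u, (m + ∑ u ∈ U, single u 1 + single v 1 + single v 1 : V →₀ ℕ) u =
          m u + (if u ∈ U then 1 else 0) + (if u = v then 2 else 0) := fun u => by
        simp only [Finsupp.add_apply, sum_single_one_apply, Finsupp.single_apply, @eq_comm V v]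
        split_ifs <;> omega
      refine ⟨M, _, h.extend (n := m + ∑ u ∈ U, single u 1 + single v 1 + single v 1)
          hv hvT hTZ hN hU ?_ ?_ ?_ ?_⟩
      · rw [happ]
        simp [hmv, hvU]
      · intro u hu
        have h1 := hmU u hu
        have huv : u ≠ v := by rintro rfl; exact hvU hu
        rw [happ, if_neg huv, if_pos hu]
        omega
      · intro u huv huU
        rw [happ, if_neg huv, if_neg huU]
        omega
      · rw [hprod, coeff_mul_X_add_X _ hvx.ne]
        · exact htwo
        · simp only [Finsupp.add_apply, sum_single_one_apply, hmx, if_neg hxU]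
          simp [hvx.ne]
  · push Not at hex
    have hNU : N = insert x U := by
      ext u
      simp only [Finset.mem_insert, hUdef, Finset.mem_filter]
      constructor
      · intro hu
        by_cases huZ : G.Touches Z u
        · exact Or.inl (hex u hu huZ)
        · exact Or.inr ⟨hu, huZ⟩
      · rintro (rfl | hu)
        · exact (hN u).2 ⟨hTW hxT, hvx⟩
        · exact hu.1
    have happ : ∀ u, (m + ∑ u ∈ U, single u 1 + single v 1 : V →₀ ℕ) u =
        m u + (if u ∈ U then 1 else 0) + (if u = v then 1 else 0) := fun u => by
      simp only [Finsupp.add_apply, sum_single_one_apply, Finsupp.single_apply, @eq_comm V v]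
    refine ⟨M, _, h.extend (n := m + ∑ u ∈ U, single u 1 + single v 1)
        hv hvT hTZ hN hU ?_ ?_ ?_ ?_⟩
    · rw [happ]
      simp [hmv, hvU]
    · intro u hu
      have h1 := hmU u hu
      have huv : u ≠ v := by rintro rfl; exact hvU hu
      rw [happ, if_neg huv, if_pos hu]
      omega
    · intro u huv huU
      rw [happ, if_neg huv, if_neg huU]
      omega
    · rw [hNU, Finset.prod_insert hxU, mul_comm (X v + X x), ← mul_assoc,
        coeff_mul_X_add_X _ hvx.ne, coeff_mul_star hmv hvU]
      · exact h.coeff_ne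
      · rw [Finsupp.add_apply, sum_single_one_apply, hmx, if_neg hxU]

/-- Release the vertex `y` of the pair `{x, y}`. -/
lemma IsGood.of_pair {x y : V} (hxW : x ∈ W) (hyW : y ∈ W) (hxy : G.Adj x y)
    (h : IsGood K G Z W {x, y} M m) : IsGood K G Z W {x} M (m + single y 1) := by
  have hmx := h.eq_zero x (by simp)
  have hmy := h.eq_zero y (by simp)
  have happ : ∀ u, (m + single y 1 : V →₀ ℕ) u = if u = y then 1 else m u := fun u => by
    rw [Finsupp.add_apply, Finsupp.single_apply]
    by_cases huy : u = y
    · rw [if_pos huy.symm, if_pos huy, huy, hmy]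
    · rw [if_neg (Ne.symm huy), if_neg huy, add_zero]
  refine ⟨h.subset, h.eq_of_mem, fun e he v hv hvx => h.notMem e he v hv (by simp_all), ?_, ?_,
    ?_, ?_, ?_, ?_⟩
  · intro v hv
    rw [happ, if_neg (by rintro rfl; exact hv hyW), h.support v hv]
  · intro v hv
    rw [Finset.mem_singleton] at hv
    rw [hv, happ, if_neg hxy.ne, hmx]
  · intro v hv hvZ
    have := h.le_two v hv hvZ
    rw [happ]
    split_ifs <;> omega
  · intro v hv hvZ e he hve
    have := h.le_one v hv hvZ e he hve
    rw [happ]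
    split_ifs <;> omega
  · intro v
    have := h.le_three v
    rw [happ]
    split_ifs <;> omega
  · have hyM : ∀ e ∈ M, y ∉ e := fun e he hye => h.notMem e he y hye (by simp)
    have hE : (G.edgesIn W \ G.edgesIn {x}) \ M =
        ((G.edgesIn W \ G.edgesIn {x, y}) \ M) ∪ star y {x} := by
      ext e
      have hye := hyM e
      induction e with
      | _ a b =>
        simp only [Sym2.mem_iff] at hye
        simp only [Finset.mem_union, Finset.mem_sdiff, mk_mem_edgesIn, mk_mem_star,
          Finset.mem_singleton, Finset.mem_insert]
        have := @SimpleGraph.Adj.symm V G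
        have := G.loopless.irrefl
        grind
    have hdisj : Disjoint ((G.edgesIn W \ G.edgesIn {x, y}) \ M) (star y {x}) := by
      rw [Finset.disjoint_left]
      intro e
      induction e with
      | _ a b =>
        simp only [Finset.mem_sdiff, mk_mem_edgesIn, mk_mem_star, Finset.mem_singleton,
          Finset.mem_insert]
        grind
    rw [hE, edgePoly_union hdisj, edgePoly_star, Finset.prod_singleton,
      coeff_mul_X_add_X hmx hxy.ne']
    exact h.coeff_ne

lemma IsGood.of_singleton {x : V} (h : IsGood K G Z W {x} M m) : IsGood K G Z W ∅ M m := by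
  have hE : G.edgesIn {x} = G.edgesIn ∅ := by
    ext e
    induction e with
    | _ a b =>
      simp only [mk_mem_edgesIn, Finset.mem_singleton, Finset.notMem_empty, and_false, iff_false]
      rintro ⟨hab, rfl, rfl⟩
      exact G.loopless.irrefl _ hab
  exact ⟨h.subset, h.eq_of_mem, by simp, h.support, by simp, h.le_two, h.le_one, h.le_three,
    hE ▸ h.coeff_ne⟩

/-- If the vertex `s` separates two vertices of `W.erase v`, then some nonempty set `C` avoiding
the clique `T` is cut off from the rest of `W` by `v` and `s`. -/
lemma Separates.exists_finset {v s p q : V} (hT : (T : Set V).Pairwise G.Adj)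
    (hq : q ∈ W) (hqv : q ≠ v) (hqs : q ≠ s) (h : G.Separates (W.erase v) s p q) :
    ∃ C : Finset V, C ⊆ (W.erase v).erase s ∧ C.Nonempty ∧ ((W.erase v).erase s \ C).Nonempty ∧
      (∀ t ∈ T, t ∉ C) ∧ ∀ u ∈ C, ∀ r ∈ W, G.Adj u r → r ∈ C ∪ {v, s} := by
  classical
  obtain ⟨C', hC', hp, hqC, hcl⟩ := h
  set X := (W.erase v).erase s with hX
  have hmem : ∀ u, u ∈ (↑(W.erase v) \ {s} : Set V) ↔ u ∈ X := fun u => by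
    simp [hX]
    tauto
  set C : Finset V := X.filter (· ∈ C') with hCdef
  have hpX : p ∈ X := (hmem p).1 (hC' hp)
  have hqX : q ∈ X := by simp [hX, hq, hqv, hqs]
  have hpC : p ∈ C := by simp [hCdef, hpX, hp]
  have hqC : q ∈ X \ C := by simp [hCdef, hqX, hqC]
  have hcl1 : ∀ u ∈ C, ∀ r ∈ X, G.Adj u r → r ∈ C := by
    intro u hu r hr hur
    simp only [hCdef, Finset.mem_filter] at hu ⊢
    exact ⟨hr, hcl u hu.2 r ((hmem r).2 hr) hur⟩
  have hout : ∀ r ∈ W, r ∉ X → r ∈ ({v, s} : Finset V) := by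
    intro r hr hrX
    simp only [hX, Finset.mem_erase, Finset.mem_insert, Finset.mem_singleton] at hrX ⊢
    tauto
  by_cases hTC : ∀ t ∈ T, t ∉ C
  · refine ⟨C, Finset.filter_subset _ _, ⟨p, hpC⟩, ⟨q, hqC⟩, hTC, ?_⟩
    intro u hu r hr hur
    by_cases hrX : r ∈ X
    · exact Finset.mem_union_left _ (hcl1 u hu r hrX hur)
    · exact Finset.mem_union_right _ (hout r hr hrX)
  · push Not at hTC
    obtain ⟨t, htT, htC⟩ := hTC
    refine ⟨X \ C, Finset.sdiff_subset, ⟨q, hqC⟩, ⟨p, by simp [hpX, hpC]⟩, ?_, ?_⟩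
    · intro t' ht' ht'C
      rw [Finset.mem_sdiff] at ht'C
      have hne : t ≠ t' := by rintro rfl; exact ht'C.2 htC
      exact ht'C.2 (hcl1 t htC t' ht'C.1 (hT htT ht' hne))
    · intro u hu r hr hur
      rw [Finset.mem_sdiff] at hu
      by_cases hrX : r ∈ X
      · refine Finset.mem_union_left _ (Finset.mem_sdiff.2 ⟨hrX, fun hrC => ?_⟩)
        exact hu.2 (hcl1 r hrC u hu.1 hur.symm)
      · exact Finset.mem_union_right _ (hout r hr hrX)

/-- The main induction: a planar graph with a connected set `Z` playing the role of the outer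
face admits a good pair. -/
theorem Planar.exists_isGood (hG : G.Planar) (Z : Set V) (W T : Finset V)
    (hZ : (G.induce Z).Preconnected) (hZW : Disjoint Z W) (hTW : T ⊆ W) (hT2 : T.card ≤ 2)
    (hT : (T : Set V).Pairwise G.Adj) (hTZ : ∀ t ∈ T, G.Touches Z t) :
    ∃ M m, IsGood K G Z W T M m := by
  classical
  induction hk : W.card using Nat.strong_induction_on generalizing Z W T with
  | _ k ih =>
  subst hk
  have hdisj : ∀ v, Disjoint (insert v Z) (W.erase v : Finset V) := by
    intro v
    rw [Set.disjoint_left] at hZW ⊢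
    rintro u (rfl | hu)
    · simp
    · intro h
      exact hZW hu (Finset.mem_of_mem_erase h)
  have hmono : ∀ {v u : V}, G.Touches Z u → G.Touches (insert v Z) u :=
    fun ⟨z, hz, h⟩ => ⟨z, Or.inr hz, h⟩
  -- a vertex of `T` without touched neighbours outside `T` can be removed
  have remove : ∀ (T : Finset V), T ⊆ W → T.card ≤ 2 → (T : Set V).Pairwise G.Adj →
      (∀ t ∈ T, G.Touches Z t) → ∀ x ∈ T,
      (∀ u ∈ W, G.Adj x u → u ∉ T → ¬ G.Touches Z u) → ∃ M m, IsGood K G Z W T M m := by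
    intro T hTW hT2 hT hTZ x hxT hnb
    obtain ⟨M, m, h⟩ := ih _ (Finset.card_erase_lt_of_mem (hTW hxT)) (insert x Z) (W.erase x)
      (T.erase x) (hZ.induce_insert_of_touches (hTZ x hxT)) (hdisj x)
      (Finset.erase_subset_erase _ hTW) (Finset.card_erase_le.trans hT2)
      (hT.mono (by simp)) (fun t ht => hmono (hTZ t (Finset.mem_of_mem_erase ht))) rfl
    obtain ⟨m', h'⟩ := IsGood.absorb (hTW hxT) (Or.inl hxT) hnb (fun u _ _ hu => hmono hu)
      (fun u hu => ⟨x, Or.inl rfl, hu⟩) h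
    exact ⟨M, m', h'⟩
  have pair : ∀ x ∈ W, ∀ y ∈ W, G.Adj x y → G.Touches Z x → G.Touches Z y →
      ∃ M m, IsGood K G Z W {x, y} M m := by
    intro x hx y hy hxy hxZ hyZ
    have hTW : ({x, y} : Finset V) ⊆ W := by
      intro t ht
      rcases Finset.mem_insert.1 ht with rfl | ht
      · exact hx
      · rwa [Finset.mem_singleton.1 ht]
    have hT : (({x, y} : Finset V) : Set V).Pairwise G.Adj := by
      rw [Finset.coe_pair]
      exact Set.pairwise_pair.2 fun _ => ⟨hxy, hxy.symm⟩
    have hTZ : ∀ t ∈ ({x, y} : Finset V), G.Touches Z t := by simp [hxZ, hyZ]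
    by_cases hex : ∀ u ∈ W, G.Adj x u → u ∉ ({x, y} : Finset V) → ¬ G.Touches Z u
    · exact remove _ hTW Finset.card_le_two hT hTZ x (by simp) hex
    push Not at hex
    obtain ⟨v, hv, hxv, hvT, hvZ⟩ := hex
    by_cases hw : ∀ w₁ ∈ W, ∀ w₂ ∈ W, G.Adj v w₁ → G.Adj v w₂ → G.Touches Z w₁ →
        G.Touches Z w₂ → w₁ ≠ x → w₂ ≠ x → w₁ = w₂
    · obtain ⟨M, m, h⟩ := ih _ (Finset.card_erase_lt_of_mem hv) (insert v Z) (W.erase v)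
        {x, y} (hZ.induce_insert_of_touches hvZ) (hdisj v)
        (fun t ht => Finset.mem_erase.2 ⟨by rintro rfl; exact hvT ht, hTW ht⟩)
        Finset.card_le_two hT (fun t ht => hmono (hTZ t ht)) rfl
      exact h.exists_extend hv hvT hTW hTZ (by simp) hxv.symm hw
    push Not at hw
    obtain ⟨w₁, hw₁, w₂, hw₂, hvw₁, hvw₂, hw₁Z, hw₂Z, hw₁x, hw₂x, hw₁₂⟩ := hw
    -- a separation of `W` along the edge `s(v, s)` of touched vertices
    have cut : ∀ s p q : V, s ∈ W → G.Adj v s → G.Touches Z s → q ∈ W → q ≠ v → q ≠ s →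
        G.Separates (W.erase v) s p q → ∃ M m, IsGood K G Z W {x, y} M m := by
      intro s p q hs hvs hsZ hq hqv hqs hsep
      obtain ⟨C, hCX, hCne, ⟨r, hr⟩, hTC, hcl⟩ := hsep.exists_finset hT hq hqv hqs
      have hCW : C ⊆ W := fun u hu => Finset.mem_of_mem_erase (Finset.mem_of_mem_erase (hCX hu))
      have hSW : ({v, s} : Finset V) ⊆ W \ C := by
        intro t ht
        rw [Finset.mem_sdiff]
        rcases Finset.mem_insert.1 ht with rfl | ht
        · exact ⟨hv, fun h => by simpa using hCX h⟩
        · rw [Finset.mem_singleton.1 ht]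
          exact ⟨hs, fun h => by simpa using hCX h⟩
      have hCSW : C ∪ {v, s} ⊆ W :=
        Finset.union_subset hCW (hSW.trans Finset.sdiff_subset)
      have hcard₁ : (W \ C).card < W.card := by
        refine Finset.card_lt_card ((Finset.ssubset_iff_of_subset Finset.sdiff_subset).2 ?_)
        obtain ⟨u, hu⟩ := hCne
        exact ⟨u, hCW hu, by simp [hu]⟩
      have hcard₂ : (C ∪ {v, s}).card < W.card := by
        refine Finset.card_lt_card ((Finset.ssubset_iff_of_subset hCSW).2 ⟨r, ?_⟩)
        simp only [Finset.mem_sdiff, Finset.mem_erase] at hr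
        simp [hr]
      have hST : (({v, s} : Finset V) : Set V).Pairwise G.Adj := by
        rw [Finset.coe_pair]
        exact Set.pairwise_pair.2 fun _ => ⟨hvs, hvs.symm⟩
      obtain ⟨M₁, m₁, h₁⟩ := ih _ hcard₁ Z (W \ C) {x, y} hZ
        (hZW.mono_right (by exact_mod_cast Finset.sdiff_subset))
        (fun t ht => Finset.mem_sdiff.2 ⟨hTW ht, hTC t ht⟩) Finset.card_le_two hT hTZ rfl
      obtain ⟨M₂, m₂, h₂⟩ := ih _ hcard₂ Z (C ∪ {v, s}) {v, s} hZ
        (hZW.mono_right (by exact_mod_cast hCSW)) Finset.subset_union_right Finset.card_le_two hST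
        (by simp [hvZ, hsZ]) rfl
      exact ⟨_, _, IsGood.glue hCW hSW hTC hcl h₁ h₂⟩
    have hZne : Nonempty Z := by
      obtain ⟨z, hz, -⟩ := hvZ
      exact ⟨z, hz⟩
    have hmem : ∀ u ∈ W, G.Adj v u → u ∈ (↑(W.erase v) : Set V) := fun u hu hvu => by
      simp [hu, hvu.ne']
    have hvnZ : v ∉ Z := fun h => Set.disjoint_left.1 hZW h hv
    rcases hG.separates (X := (W.erase v : Finset V)) ⟨hZ⟩
      ((hdisj v).mono_left (Set.subset_insert _ _)) (by simp) hvnZ (hmem x hx hxv.symm)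
      (hmem w₁ hw₁ hvw₁) (hmem w₂ hw₂ hvw₂) hw₁x.symm hw₂x.symm hw₁₂ hvZ hxZ hw₁Z hw₂Z hxv.symm
      hvw₁ hvw₂ with hsep | hsep | hsep
    · exact cut x w₁ w₂ hx hxv.symm hxZ hw₂ hvw₂.ne' hw₂x hsep
    · exact cut w₁ w₂ x hw₁ hvw₁ hw₁Z hx hxv.ne hw₁x.symm hsep
    · exact cut w₂ x w₁ hw₂ hvw₂ hw₂Z hw₁ hvw₁.ne' hw₁₂ hsep
  have single : ∀ x ∈ W, G.Touches Z x → ∃ M m, IsGood K G Z W {x} M m := by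
    intro x hx hxZ
    by_cases hex : ∀ u ∈ W, G.Adj x u → u ∉ ({x} : Finset V) → ¬ G.Touches Z u
    · exact remove {x} (by simpa using hx) (by simp) (by simp) (by simpa using hxZ) x (by simp) hex
    push Not at hex
    obtain ⟨y, hy, hxy, -, hyZ⟩ := hex
    obtain ⟨M, m, h⟩ := pair x hx y hy hxy hxZ hyZ
    exact ⟨M, _, h.of_pair hx hy hxy⟩
  obtain rfl | ⟨x, hxT⟩ := T.eq_empty_or_nonempty
  · by_cases hex : ∃ x ∈ W, G.Touches Z x
    · obtain ⟨x, hx, hxZ⟩ := hex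
      obtain ⟨M, m, h⟩ := single x hx hxZ
      exact ⟨M, m, h.of_singleton⟩
    push Not at hex
    obtain rfl | ⟨x, hx⟩ := W.eq_empty_or_nonempty
    · refine ⟨∅, 0, by simp, by simp, by simp, by simp, by simp, by simp, by simp, by simp, ?_⟩
      simp [edgePoly]
    · obtain ⟨M, m, h⟩ := ih _ (Finset.card_erase_lt_of_mem hx) {x} (W.erase x) ∅
        (induce_singleton_connected x).preconnected (by simp) (by simp) (by simp) (by simp)
        (by simp) rfl
      obtain ⟨m', h'⟩ := IsGood.absorb (Z := Z) (Z' := {x}) (T := ∅) hx (Or.inr rfl)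
        (fun u hu _ _ => hex u hu) (fun u hu _ huZ => absurd huZ (hex u hu))
        (fun u hu => ⟨x, rfl, hu⟩) (by simpa using h)
      exact ⟨M, m', h'⟩
  · by_cases hTx : T = {x}
    · rw [hTx]
      exact single x (hTW hxT) (hTZ x hxT)
    · obtain ⟨y, hyT, hyx⟩ : ∃ y ∈ T, y ≠ x := by
        by_contra! hcon
        exact hTx (Finset.eq_singleton_iff_unique_mem.2 ⟨hxT, hcon⟩)
      have hTxy : {x, y} = T := by
        refine Finset.eq_of_subset_of_card_le ?_ ?_
        · simp [Finset.insert_subset_iff, hxT, hyT]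
        · rwa [Finset.card_pair hyx.symm]
      rw [← hTxy]
      exact pair x (hTW hxT) y (hTW hyT) (hT hxT hyT hyx.symm) (hTZ x hxT) (hTZ y hyT)

end GoodMatching

end SimpleGraph

/-- Grytczuk–Zhu: every planar graph `G` contains a matching `𝓜` such that `G - 𝓜` is
`4`-choosable. -/
theorem stmt11 {V : Type} [Fintype V] [DecidableEq V]
    (G : SimpleGraph V) (hG : G.Planar) :
    ∃ (n : ℕ) (r g : Fin n → V),
      (∀ i, G.Adj (r i) (g i)) ∧
      Function.Injective (Sum.elim r g) ∧
      (G.deleteEdges {e | ∃ i, e = s(r i, g i)}).Choosable 4 := by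
  obtain ⟨M, m, h⟩ := hG.exists_isGood (K := AlgebraicClosure (ZMod 2)) ∅ Finset.univ ∅
    (fun u => u.2.elim) (by simp) (by simp) (by simp) (by simp) (by simp)
  have hM : ∀ e ∈ M, e ∈ G.edgeSet := fun e he => by
    have := h.subset he
    simp only [SimpleGraph.edgesIn, Finset.mem_filter] at this
    exact this.2.1
  obtain ⟨n, r, g, hadj, hinj, hrg⟩ := SimpleGraph.exists_fin_enum_of_matching hM h.eq_of_mem
  refine ⟨n, r, g, hadj, hinj, fun L hL => ?_⟩
  have : CharP (AlgebraicClosure (ZMod 2)) 2 := charP_of_injective_algebraMap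
    (algebraMap (ZMod 2) (AlgebraicClosure (ZMod 2))).injective 2
  obtain ⟨c, hc, hcol⟩ := SimpleGraph.exists_coloring_of_coeff_ne_zero h.coeff_ne L
    (fun v => (Nat.lt_succ_of_le (h.le_three v)).trans_le (hL v))
  refine ⟨c, hc, fun u w huw => hcol u w ?_⟩
  rw [hrg, SimpleGraph.deleteEdges_adj] at huw
  simp only [Finset.mem_sdiff, SimpleGraph.mk_mem_edgesIn]
  exact ⟨⟨⟨huw.1, Finset.mem_univ _, Finset.mem_univ _⟩, by simp⟩, huw.2⟩
end
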